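/- arXiv:2006.13923 — 3 statements merged into one kernel-verified Lean document; each statement's English description precedes it below -/
import Mathlib

section
/- Let g ∈ ℝ[z_1,…,z_n] be a multi-affine real stable polynomial such that the coefficient of z_1⋯z_n in g equals 1 and all roots of the diagonalization ḡ lie in [0,1]. Then for every b > 1, the point b·𝟏 = (b,…,b) ∈ ℝ^n is above the roots of g. -/
open MvPolynomial Polynomial

/-- A polynomial with real coefficients is *real stable* if it does not vanish
when all variables have positive imaginary part. -/
def RealStable {n : ℕ} (p : MvPolynomial (Fin n) ℝ) : Prop :=
  ∀ z : Fin n → ℂ, (∀ i, 0 < (z i).im) →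
    MvPolynomial.eval z (MvPolynomial.map (algebraMap ℝ ℂ) p) ≠ 0

/-- A polynomial is *multi-affine* if it has degree at most 1 in each variable. -/
def MultiAffine {n : ℕ} (p : MvPolynomial (Fin n) ℝ) : Prop :=
  ∀ i, p.degreeOf i ≤ 1

/-- The diagonalization `p̄(x) = p(x,…,x)` of a multivariate polynomial. -/
noncomputable def diagPoly {n : ℕ} (p : MvPolynomial (Fin n) ℝ) : Polynomial ℝ :=
  MvPolynomial.aeval (fun _ => Polynomial.X) p

/-- The exponent of the multi-affine monomial `∏_{i ∈ A} z_i`. -/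
noncomputable def expOf {n : ℕ} (A : Finset (Fin n)) : Fin n →₀ ℕ :=
  ∑ i ∈ A, Finsupp.single i 1

/-- `∂^S p = (∏_{i ∈ S} ∂/∂z_i) p`. -/
noncomputable def pderivs {n : ℕ} (S : Finset (Fin n)) (p : MvPolynomial (Fin n) ℝ) :
    MvPolynomial (Fin n) ℝ :=
  S.toList.foldr (fun i q => MvPolynomial.pderiv i q) p

/-- `u` is above the roots of `p`: `p(w) ≠ 0` for every `w ≥ u` coordinatewise. -/
def AboveRoots {n : ℕ} (p : MvPolynomial (Fin n) ℝ) (u : Fin n → ℝ) : Prop :=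
  ∀ w : Fin n → ℝ, (∀ i, u i ≤ w i) → MvPolynomial.eval w p ≠ 0

/-- A multi-affine polynomial is affine in each variable. -/
theorem MultiAffine.aeval_update {n : ℕ} {g : MvPolynomial (Fin n) ℝ} (hma : MultiAffine g)
    {R : Type*} [CommRing R] [Algebra ℝ R] (z : Fin n → R) (i : Fin n) (s : R) :
    MvPolynomial.aeval (Function.update z i (z i + s)) g =
      MvPolynomial.aeval z g + s * (MvPolynomial.aeval (Function.update z i (z i + 1)) g -
        MvPolynomial.aeval z g) := by
  simp only [MvPolynomial.aeval_def, MvPolynomial.eval₂_eq']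
  rw [← Finset.sum_sub_distrib, Finset.mul_sum, ← Finset.sum_add_distrib]
  refine Finset.sum_congr rfl fun m hm => ?_
  have hmi : m i ≤ 1 := (MvPolynomial.degreeOf_le_iff.mp (hma i)) m hm
  have key (a : R) : ∏ j, Function.update z i a j ^ m j =
      a ^ m i * ∏ j ∈ Finset.univ.erase i, z j ^ m j := by
    rw [← Finset.mul_prod_erase _ _ (Finset.mem_univ i), Function.update_self]
    congr 1
    refine Finset.prod_congr rfl fun j hj => ?_
    rw [Function.update_of_ne (Finset.ne_of_mem_erase hj)]
  rw [key, key, ← Finset.mul_prod_erase _ _ (Finset.mem_univ i)]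
  interval_cases m i <;> ring

/-- The restriction `t ↦ p(x₁ + t, …, xₙ + t)` of `p` to the diagonal line through `x`. -/
noncomputable def diagLine {n : ℕ} (p : MvPolynomial (Fin n) ℝ) (x : Fin n → ℝ) :
    Polynomial ℝ :=
  MvPolynomial.aeval (fun i => Polynomial.X + Polynomial.C (x i)) p

theorem aeval_diagLine {n : ℕ} (p : MvPolynomial (Fin n) ℝ) (x : Fin n → ℝ)
    {R : Type*} [CommRing R] [Algebra ℝ R] (t : R) :
    Polynomial.aeval t (diagLine p x) =
      MvPolynomial.aeval (fun i => t + algebraMap ℝ R (x i)) p := by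
  rw [diagLine, MvPolynomial.comp_aeval_apply]
  simp

theorem expOf_univ_apply {n : ℕ} (i : Fin n) : expOf (Finset.univ : Finset (Fin n)) i = 1 := by
  simp [expOf, Finsupp.single_apply]

theorem MultiAffine.natDegree_diagLine_le {n : ℕ} {g : MvPolynomial (Fin n) ℝ}
    (hma : MultiAffine g) (x : Fin n → ℝ) : (diagLine g x).natDegree ≤ n := by
  rw [diagLine, MvPolynomial.aeval_def, MvPolynomial.eval₂_eq']
  refine Polynomial.natDegree_sum_le_of_forall_le _ _ fun m hm => ?_
  refine (Polynomial.natDegree_C_mul_le _ _).trans ?_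
  refine (Polynomial.natDegree_prod_le _ _).trans ?_
  calc ∑ j, ((Polynomial.X + Polynomial.C (x j)) ^ m j).natDegree
      ≤ ∑ _j : Fin n, 1 := by
        refine Finset.sum_le_sum fun j _ => ?_
        rw [Polynomial.natDegree_pow, Polynomial.natDegree_X_add_C, mul_one]
        exact MvPolynomial.degreeOf_le_iff.mp (hma j) m hm
    _ = n := by simp

theorem MultiAffine.coeff_diagLine {n : ℕ} {g : MvPolynomial (Fin n) ℝ}
    (hma : MultiAffine g) (x : Fin n → ℝ) :
    (diagLine g x).coeff n = MvPolynomial.coeff (expOf Finset.univ) g := by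
  have hmonic (m : Fin n →₀ ℕ) :
      (∏ j, (Polynomial.X + Polynomial.C (x j)) ^ m j).Monic :=
    Polynomial.monic_prod_of_monic _ _ fun j _ => (Polynomial.monic_X_add_C _).pow _
  have hdeg (m : Fin n →₀ ℕ) :
      (∏ j, (Polynomial.X + Polynomial.C (x j)) ^ m j).natDegree = ∑ j, m j := by
    rw [Polynomial.natDegree_prod_of_monic _ _ fun j _ => (Polynomial.monic_X_add_C _).pow _]
    simp
  rw [diagLine, MvPolynomial.aeval_def, MvPolynomial.eval₂_eq', Polynomial.finsetSum_coeff]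
  simp only [Polynomial.algebraMap_eq, Polynomial.coeff_C_mul]
  rw [Finset.sum_eq_single (expOf Finset.univ)]
  · have h := (hmonic (expOf Finset.univ)).coeff_natDegree
    rw [hdeg] at h
    simp only [expOf_univ_apply, Finset.sum_const, Finset.card_univ, Fintype.card_fin,
      smul_eq_mul, mul_one] at h
    simp only [expOf_univ_apply, h, mul_one]
  · intro m hm hne
    have hle (j : Fin n) : m j ≤ 1 := MvPolynomial.degreeOf_le_iff.mp (hma j) m hm
    obtain ⟨i, hi⟩ : ∃ i, m i < 1 := by
      by_contra! h
      exact hne (Finsupp.ext fun j => by rw [expOf_univ_apply]; exact le_antisymm (hle j) (h j))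
    rw [Polynomial.coeff_eq_zero_of_natDegree_lt, mul_zero]
    rw [hdeg]
    calc ∑ j, m j < ∑ _j : Fin n, 1 :=
          Finset.sum_lt_sum (fun j _ => hle j) ⟨i, Finset.mem_univ i, hi⟩
      _ = n := by simp
  · intro h
    rw [MvPolynomial.notMem_support_iff.mp h, zero_mul]

/-- If `A + s B` has no zeros with `t` and `s` in the upper half plane, then the quotient `B / A` has nonpositive derivative at real points where `A` does not vanish. -/
theorem deriv_eval_div_eval_nonpos {A B : Polynomial ℝ}
    (hA : ∀ t : ℂ, 0 < t.im → Polynomial.aeval t A ≠ 0)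
    (hAB : ∀ t s : ℂ, 0 < t.im → 0 < s.im →
      Polynomial.aeval t A + s * Polynomial.aeval t B ≠ 0)
    {t : ℝ} (ht : A.eval t ≠ 0) :
    deriv (fun u => B.eval u / A.eval u) t ≤ 0 := by
  have him (z : ℂ) (hz : 0 < z.im) :
      (Polynomial.aeval z B / Polynomial.aeval z A).im ≤ 0 := by
    by_contra! h
    set w := Polynomial.aeval z B / Polynomial.aeval z A with hw
    have hw0 : w ≠ 0 := by
      rintro h0
      simp [h0] at h
    have hB : Polynomial.aeval z B = w * Polynomial.aeval z A := by
      rw [hw, div_mul_cancel₀ _ (hA z hz)]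
    refine hAB z (-w⁻¹) hz ?_ ?_
    · rw [Complex.neg_im, Complex.inv_im, neg_div, neg_neg]
      exact div_pos h (Complex.normSq_pos.mpr hw0)
    · rw [hB]
      field_simp
      ring
  have hofReal (P : Polynomial ℝ) (u : ℝ) : Polynomial.aeval (u : ℂ) P = ((P.eval u : ℝ) : ℂ) :=
    Polynomial.aeval_algebraMap_apply_eq_algebraMap_eval u P
  have hline : HasDerivAt (fun ε : ℝ => (t : ℂ) + ε * Complex.I) Complex.I 0 := by
    simpa using ((Complex.ofRealCLM.hasDerivAt (x := (0 : ℝ))).mul_const Complex.I).const_add (t : ℂ)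
  have hcomp (P : Polynomial ℝ) : HasDerivAt
      (fun ε : ℝ => Polynomial.aeval ((t : ℂ) + ε * Complex.I) P)
      (((P.derivative.eval t : ℝ) : ℂ) * Complex.I) 0 := by
    have h := P.hasDerivAt_aeval ((t : ℂ) + ((0 : ℝ) : ℂ) * Complex.I)
    have h' := h.comp (0 : ℝ) hline
    simpa [hofReal, Function.comp_def] using h'
  have hA0 : Polynomial.aeval ((t : ℂ) + ((0 : ℝ) : ℂ) * Complex.I) A ≠ 0 := by
    simpa [hofReal] using ht
  have hquot := (hcomp B).div (hcomp A) hA0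
  have hquot_im := Complex.imCLM.hasFDerivAt.comp_hasDerivAt (0 : ℝ) hquot
  have hreal := ((B.hasDerivAt t).div (A.hasDerivAt t) ht).deriv
  have hreal' : deriv (fun u => B.eval u / A.eval u) t =
    (B.derivative.eval t * A.eval t - B.eval t * A.derivative.eval t) / A.eval t ^ 2 := hreal
  have hval : Complex.imCLM
      ((((B.derivative.eval t : ℝ) : ℂ) * Complex.I *
          Polynomial.aeval ((t : ℂ) + ((0 : ℝ) : ℂ) * Complex.I) A -
        Polynomial.aeval ((t : ℂ) + ((0 : ℝ) : ℂ) * Complex.I) B *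
          (((A.derivative.eval t : ℝ) : ℂ) * Complex.I)) /
        Polynomial.aeval ((t : ℂ) + ((0 : ℝ) : ℂ) * Complex.I) A ^ 2) =
      deriv (fun u => B.eval u / A.eval u) t := by
    rw [hreal']
    simp only [Complex.ofReal_zero, zero_mul, add_zero, hofReal, Complex.imCLM_apply]
    rw [show (((B.derivative.eval t : ℝ) : ℂ) * Complex.I * ((A.eval t : ℝ) : ℂ) -
        ((B.eval t : ℝ) : ℂ) * (((A.derivative.eval t : ℝ) : ℂ) * Complex.I)) /
        ((A.eval t : ℝ) : ℂ) ^ 2 =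
        (((B.derivative.eval t * A.eval t - B.eval t * A.derivative.eval t) / A.eval t ^ 2 : ℝ) :
          ℂ) * Complex.I by push_cast; ring]
    rw [Complex.im_ofReal_mul, Complex.I_im, mul_one]
  rw [hval] at hquot_im
  refine le_of_tendsto (hquot_im.tendsto_slope_zero_right) ?_
  filter_upwards [self_mem_nhdsWithin] with ε hε
  have hε : (0 : ℝ) < ε := hε
  have h1 := him ((t : ℂ) + ε * Complex.I) (by simpa using hε)
  have h0 : (Polynomial.aeval (t : ℂ) B / Polynomial.aeval (t : ℂ) A).im = 0 := by
    rw [hofReal, hofReal, ← Complex.ofReal_div, Complex.ofReal_im]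
  simp only [Function.comp_apply, Pi.div_apply, zero_add, Complex.ofReal_zero, zero_mul, add_zero,
    Complex.imCLM_apply, smul_eq_mul, h0, sub_zero]
  exact mul_nonpos_of_nonneg_of_nonpos (inv_nonneg.mpr hε.le) h1

theorem eval_div_eval_nonneg {A B : Polynomial ℝ} (hdeg : B.degree < A.degree)
    (hA : ∀ t : ℂ, 0 < t.im → Polynomial.aeval t A ≠ 0)
    (hAB : ∀ t s : ℂ, 0 < t.im → 0 < s.im →
      Polynomial.aeval t A + s * Polynomial.aeval t B ≠ 0)
    {a : ℝ} (ha : ∀ t, a ≤ t → A.eval t ≠ 0) {t : ℝ} (ht : a ≤ t) :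
    0 ≤ B.eval t / A.eval t := by
  have hanti : AntitoneOn (fun u => B.eval u / A.eval u) (Set.Ici a) := by
    refine antitoneOn_of_deriv_nonpos (convex_Ici a) ?_ ?_ ?_
    · exact B.continuous.continuousOn.div A.continuous.continuousOn fun u hu => ha u hu
    · intro u hu
      exact (B.differentiableAt.div A.differentiableAt
        (ha u (interior_subset hu))).differentiableWithinAt
    · intro u hu
      exact deriv_eval_div_eval_nonpos hA hAB (ha u (interior_subset hu))
  refine le_of_tendsto (Polynomial.div_tendsto_atTop_zero_of_degree_lt B A hdeg) ?_
  filter_upwards [Filter.eventually_ge_atTop t] with u hu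
  exact hanti ht (ht.trans hu) hu

theorem RealStable.aeval_ne_zero {n : ℕ} {g : MvPolynomial (Fin n) ℝ} (h : RealStable g)
    {z : Fin n → ℂ} (hz : ∀ i, 0 < (z i).im) : MvPolynomial.aeval z g ≠ 0 := by
  have := h z hz
  rwa [MvPolynomial.eval_map, ← MvPolynomial.aeval_def] at this

/-- Increasing one coordinate keeps the upper diagonal ray free of zeros. -/
theorem eval_diagLine_update_ne_zero {n : ℕ} {g : MvPolynomial (Fin n) ℝ}
    (hstable : RealStable g) (hma : MultiAffine g)
    (hcoeff : MvPolynomial.coeff (expOf (Finset.univ : Finset (Fin n))) g ≠ 0)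
    {x : Fin n → ℝ} (hx : ∀ t, 0 ≤ t → (diagLine g x).eval t ≠ 0)
    (i : Fin n) {s : ℝ} (hs : 0 ≤ s) {t : ℝ} (ht : 0 ≤ t) :
    (diagLine g (Function.update x i (x i + s))).eval t ≠ 0 := by
  have hshift {R : Type} [CommRing R] [Algebra ℝ R] (t : R) (s : ℝ) :
      (fun j => t + algebraMap ℝ R (Function.update x i (x i + s) j)) =
        Function.update (fun j => t + algebraMap ℝ R (x j)) i
          (t + algebraMap ℝ R (x i) + algebraMap ℝ R s) := by
    ext j
    rcases eq_or_ne j i with rfl | hj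
    · simp [add_assoc]
    · simp [hj]
  set A := diagLine g x with hA
  set B := diagLine g (Function.update x i (x i + 1)) - A with hB
  have hline {R : Type} [CommRing R] [Algebra ℝ R] (t s : R) :
      MvPolynomial.aeval (Function.update (fun j => t + algebraMap ℝ R (x j)) i
          (t + algebraMap ℝ R (x i) + s)) g =
        Polynomial.aeval t A + s * Polynomial.aeval t B := by
    rw [hB, map_sub, hA, aeval_diagLine, aeval_diagLine, hshift, map_one]
    exact hma.aeval_update (fun j => t + algebraMap ℝ R (x j)) i s
  have hAdeg : A.natDegree = n :=
    Polynomial.natDegree_eq_of_le_of_coeff_ne_zero (hma.natDegree_diagLine_le x)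
      (by rwa [hma.coeff_diagLine])
  have hA0 : A ≠ 0 := fun h => hx 0 le_rfl (by rw [h, Polynomial.eval_zero])
  have hdeg : B.degree < A.degree := by
    rw [Polynomial.degree_eq_natDegree hA0, hAdeg, Polynomial.degree_lt_iff_coeff_zero]
    intro m hm
    rcases hm.eq_or_lt with rfl | hm
    · rw [hB, hA, Polynomial.coeff_sub, hma.coeff_diagLine, hma.coeff_diagLine, sub_self]
    · rw [hB, hA, Polynomial.coeff_sub,
        Polynomial.coeff_eq_zero_of_natDegree_lt ((hma.natDegree_diagLine_le _).trans_lt hm),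
        Polynomial.coeff_eq_zero_of_natDegree_lt ((hma.natDegree_diagLine_le _).trans_lt hm),
        sub_zero]
  have hAC (t : ℂ) (ht : 0 < t.im) : Polynomial.aeval t A ≠ 0 := by
    rw [hA, aeval_diagLine]
    exact hstable.aeval_ne_zero fun j => by simpa using ht
  have hABC (t s : ℂ) (ht : 0 < t.im) (hs : 0 < s.im) :
      Polynomial.aeval t A + s * Polynomial.aeval t B ≠ 0 := by
    rw [← hline]
    refine hstable.aeval_ne_zero fun j => ?_
    rcases eq_or_ne j i with rfl | hj
    · simpa using add_pos ht hs
    · simpa [hj] using ht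
  have hnonneg := eval_div_eval_nonneg hdeg hAC hABC hx ht
  have heval : (diagLine g (Function.update x i (x i + s))).eval t =
      A.eval t * (1 + s * (B.eval t / A.eval t)) := by
    rw [← Polynomial.coe_aeval_eq_eval, aeval_diagLine, hshift, hline, Algebra.algebraMap_self,
      RingHom.id_apply, Polynomial.coe_aeval_eq_eval]
    have := hx t ht
    field_simp
  rw [heval]
  exact mul_ne_zero (hx t ht) (by positivity)

theorem stmt13 (n : ℕ) (g : MvPolynomial (Fin n) ℝ)
    (hstable : RealStable g) (hma : MultiAffine g)
    (ha0 : MvPolynomial.coeff (expOf (Finset.univ : Finset (Fin n))) g = 1)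
    (hroots : ∀ x : ℝ, (diagPoly g).IsRoot x → x ∈ Set.Icc (0 : ℝ) 1) :
    ∀ b : ℝ, 1 < b → AboveRoots g (fun _ => b) := by
  intro b hb w hw
  have key (S : Finset (Fin n)) : ∀ t, 0 ≤ t →
      (diagLine g (fun i => if i ∈ S then w i else b)).eval t ≠ 0 := by
    induction S using Finset.induction_on with
    | empty =>
      intro t ht h
      have hroot : (diagPoly g).IsRoot (t + b) := by
        rw [← Polynomial.coe_aeval_eq_eval, aeval_diagLine] at h
        rw [Polynomial.IsRoot, diagPoly, ← Polynomial.coe_aeval_eq_eval,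
          MvPolynomial.comp_aeval_apply]
        simpa using h
      linarith [(hroots _ hroot).2]
    | insert i S hi ih =>
      intro t ht
      have h := eval_diagLine_update_ne_zero hstable hma (by rw [ha0]; exact one_ne_zero) ih i
        (sub_nonneg.mpr (hw i)) ht
      convert h using 3
      ext j
      rcases eq_or_ne j i with rfl | hj
      · simp [hi]
      · simp [hj]
  have h := key Finset.univ 0 le_rfl
  rw [← Polynomial.coe_aeval_eq_eval, aeval_diagLine] at h
  simpa [MvPolynomial.aeval_eq_eval] using h
end

section
/- Let p ∈ ℝ[z_1,…,z_n] with p(z) = Σ_{A ⊆ [n]} a_A z^A be a multi-affine real stable polynomial with a_{[n]} > 0. If all roots of the diagonalization p̄ are non-negative, then (−1)^{n−|A|} a_A ≥ 0 for every A ⊆ [n]. -/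
open MvPolynomial Polynomial

open Filter Topology

/-- The value at `z` of the multi-affine polynomial `∑_{A ⊆ S} a_A z^A`. -/
noncomputable def multiAffineEval {n : ℕ} (S : Finset (Fin n)) (a : Finset (Fin n) → ℝ)
    (z : Fin n → ℂ) : ℂ :=
  ∑ A ∈ S.powerset, (a A : ℂ) * ∏ i ∈ A, z i

/-- The diagonalization of the multi-affine polynomial `∑_{A ⊆ S} a_A z^A`. -/
noncomputable def multiAffineDiag {n : ℕ} (S : Finset (Fin n)) (a : Finset (Fin n) → ℝ) :
    Polynomial ℝ :=
  ∑ A ∈ S.powerset, Polynomial.C (a A) * Polynomial.X ^ A.card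

/-- A closed form of stability: `Im (q · conj (∂_i q)) ≥ 0` on the upper half-plane, where
`q = ∑_{A ⊆ S} a_A z^A` and `i ∈ S`. -/
def WeaklyStable {n : ℕ} (S : Finset (Fin n)) (a : Finset (Fin n) → ℝ) : Prop :=
  ∀ (i : Fin n) (T : Finset (Fin n)), i ∉ T → S = insert i T →
    ∀ z : Fin n → ℂ, (∀ k, 0 < (z k).im) →
      0 ≤ (multiAffineEval S a z *
        (starRingEnd ℂ) (multiAffineEval T (fun A => a (insert i A)) z)).im

theorem multiAffineEval_insert {n : ℕ} {i : Fin n} {S : Finset (Fin n)} (hi : i ∉ S)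
    (a : Finset (Fin n) → ℝ) (z : Fin n → ℂ) :
    multiAffineEval (insert i S) a z =
      multiAffineEval S a z + z i * multiAffineEval S (fun A => a (insert i A)) z := by
  unfold multiAffineEval
  rw [Finset.sum_powerset_insert hi, Finset.mul_sum]
  congr 1
  refine Finset.sum_congr rfl fun A hA => ?_
  rw [Finset.prod_insert fun h => hi (Finset.mem_powerset.1 hA h)]
  ring

theorem multiAffineEval_update {n : ℕ} {i : Fin n} {S : Finset (Fin n)} (hi : i ∉ S)
    (a : Finset (Fin n) → ℝ) (z : Fin n → ℂ) (w : ℂ) :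
    multiAffineEval S a (Function.update z i w) = multiAffineEval S a z := by
  unfold multiAffineEval
  refine Finset.sum_congr rfl fun A hA => ?_
  congr 1
  refine Finset.prod_congr rfl fun k hk => ?_
  rw [Function.update_of_ne]
  rintro rfl
  exact hi (Finset.mem_powerset.1 hA hk)

theorem multiAffineEval_const {n : ℕ} (S : Finset (Fin n)) (a : Finset (Fin n) → ℝ) (t : ℂ) :
    multiAffineEval S a (fun _ => t) = Polynomial.aeval t (multiAffineDiag S a) := by
  simp [multiAffineEval, multiAffineDiag]

/-- A quadratic that is nonnegative on the positive reals has nonnegative leading coefficient. -/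
theorem nonneg_of_quadratic_nonneg {α β γ : ℝ}
    (h : ∀ M : ℝ, 0 < M → 0 ≤ α * M ^ 2 + β * M + γ) : 0 ≤ α := by
  have h0 : Tendsto (fun M : ℝ => M⁻¹) atTop (𝓝 0) := tendsto_inv_atTop_zero
  have h1 : Tendsto (fun M : ℝ => α + β * M⁻¹ + γ * (M⁻¹) ^ 2) atTop (𝓝 α) := by
    simpa using (tendsto_const_nhds.add (h0.const_mul β)).add ((h0.pow 2).const_mul γ)
  refine ge_of_tendsto h1 ?_
  filter_upwards [eventually_gt_atTop 0] with M hM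
  have h2 : α + β * M⁻¹ + γ * (M⁻¹) ^ 2 = (α * M ^ 2 + β * M + γ) / M ^ 2 := by
    field_simp
  rw [h2]
  exact div_nonneg (h M hM) (by positivity)

theorem WeaklyStable.deriv {n : ℕ} {j : Fin n} {S : Finset (Fin n)} {a : Finset (Fin n) → ℝ}
    (hj : j ∉ S) (h : WeaklyStable (insert j S) a) :
    WeaklyStable S (fun A => a (insert j A)) := by
  rintro i T hi rfl z hz
  have hji : j ≠ i := fun e => hj (e ▸ Finset.mem_insert_self _ _)
  have hjT : j ∉ T := fun e => hj (Finset.mem_insert_of_mem e)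
  have hij : i ∉ insert j T := by simp [hi, hji.symm]
  set q := multiAffineEval (insert i T) (fun A => a (insert j A)) z with hq
  set r := multiAffineEval (insert i T) a z with hr
  set s := multiAffineEval T (fun A => a (insert i (insert j A))) z with hs
  set u := multiAffineEval T (fun A => a (insert i A)) z with hu
  have hs' : multiAffineEval T (fun A => a (insert j (insert i A))) z = s := by
    simp only [hs, Finset.insert_comm]
  rw [hs']
  refine nonneg_of_quadratic_nonneg (β := q.re * u.re + q.im * u.im - r.re * s.re - r.im * s.im)
    (γ := (r * (starRingEnd ℂ) u).im) fun M hM => ?_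
  have key := h i (insert j T) hij (Finset.insert_comm _ _ _)
    (Function.update z j (M * Complex.I)) (fun k => by
      by_cases hk : k = j
      · subst hk; simpa using hM
      · simpa [hk] using hz k)
  rw [multiAffineEval_insert hj, multiAffineEval_insert hjT, multiAffineEval_update hj,
    multiAffineEval_update hj, multiAffineEval_update hjT, multiAffineEval_update hjT,
    Function.update_self, ← hq, ← hr, ← hs, ← hu] at key
  convert key using 1
  simp
  ring

theorem weaklyStable_of_ne_zero {n : ℕ} {S : Finset (Fin n)} {a : Finset (Fin n) → ℝ}
    (h : ∀ z : Fin n → ℂ, (∀ i, 0 < (z i).im) → multiAffineEval S a z ≠ 0) :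
    WeaklyStable S a := by
  rintro i T hi rfl z hz
  set q := multiAffineEval T (fun A => a (insert i A)) z with hq
  rw [multiAffineEval_insert hi, ← hq]
  set r := multiAffineEval T a z with hr
  by_cases hq0 : q = 0
  · simp [hq0]
  have hw : (-r / q).im ≤ 0 := by
    by_contra! hw
    refine h (Function.update z i (-r / q)) (fun k => ?_) ?_
    · by_cases hk : k = i
      · subst hk; simpa using hw
      · simpa [hk] using hz k
    · rw [multiAffineEval_insert hi, multiAffineEval_update hi, multiAffineEval_update hi,
        Function.update_self, ← hq, ← hr]
      field_simp
      ring
  have hqpos : 0 < Complex.normSq q := Complex.normSq_pos.2 hq0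
  have hrq : r * (starRingEnd ℂ) q = -(-r / q) * (Complex.normSq q : ℂ) := by
    rw [← Complex.mul_conj]
    field_simp
  have e : (r + z i * q) * (starRingEnd ℂ) q =
      -(-r / q) * (Complex.normSq q : ℂ) + z i * (Complex.normSq q : ℂ) := by
    rw [← hrq, ← Complex.mul_conj]
    ring
  rw [e, Complex.add_im, Complex.im_mul_ofReal, Complex.im_mul_ofReal, Complex.neg_im]
  nlinarith [hz i]

/-- If `Im (h · conj f) ≥ 0` on the upper half-plane, then the Wronskian `h' f - h f'` is
nonnegative on the real line. -/
theorem wronskian_nonneg {h f : Polynomial ℝ}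
    (H : ∀ t : ℂ, 0 < t.im →
      0 ≤ (Polynomial.aeval t h * (starRingEnd ℂ) (Polynomial.aeval t f)).im) (x : ℝ) :
    0 ≤ h.derivative.eval x * f.eval x - h.eval x * f.derivative.eval x := by
  have hline : HasDerivAt (fun ε : ℝ => (x : ℂ) + ε * Complex.I) Complex.I 0 := by
    simpa using ((Complex.ofRealCLM.hasDerivAt (x := (0 : ℝ))).mul_const Complex.I).const_add
      (x : ℂ)
  have hpoly (g : Polynomial ℝ) : HasDerivAt
      (fun ε : ℝ => Polynomial.aeval ((x : ℂ) + ε * Complex.I) g)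
      ((g.derivative.eval x : ℝ) * Complex.I) 0 := by
    have h1 : HasDerivAt (fun t : ℂ => Polynomial.aeval t g)
        ((g.derivative.eval x : ℝ) : ℂ) ((x : ℂ) + (0 : ℝ) * Complex.I) := by
      have h2 := g.hasDerivAt_aeval ((x : ℂ) + (0 : ℝ) * Complex.I)
      have h3 : Polynomial.aeval ((x : ℂ) + (0 : ℝ) * Complex.I) (Polynomial.derivative g)
          = ((g.derivative.eval x : ℝ) : ℂ) := by
        simpa using Polynomial.aeval_algebraMap_apply_eq_algebraMap_eval (A := ℂ) x
          (Polynomial.derivative g)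
      rwa [h3] at h2
    exact h1.comp (0 : ℝ) hline
  have hval (g : Polynomial ℝ) :
      Polynomial.aeval ((x : ℂ) + (0 : ℝ) * Complex.I) g = ((g.eval x : ℝ) : ℂ) := by
    simpa using Polynomial.aeval_algebraMap_apply_eq_algebraMap_eval (A := ℂ) x g
  have hprod := (hpoly h).mul (hpoly f).star
  have him := Complex.imCLM.hasFDerivAt.comp_hasDerivAt (0 : ℝ) hprod
  have hslope := him.tendsto_slope_zero_right
  have hD : Complex.imCLM ((h.derivative.eval x : ℝ) * Complex.I *
      star (Polynomial.aeval ((x : ℂ) + (0 : ℝ) * Complex.I) f) +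
      Polynomial.aeval ((x : ℂ) + (0 : ℝ) * Complex.I) h *
        star (((f.derivative.eval x : ℝ) : ℂ) * Complex.I)) =
      h.derivative.eval x * f.eval x - h.eval x * f.derivative.eval x := by
    rw [hval, hval]
    simp
    ring
  rw [hD] at hslope
  refine ge_of_tendsto hslope ?_
  filter_upwards [self_mem_nhdsWithin] with ε hε
  have hε' : (0 : ℝ) < ε := hε
  have h0 : (Polynomial.aeval ((x : ℂ) + (0 : ℝ) * Complex.I) h *
      star (Polynomial.aeval ((x : ℂ) + (0 : ℝ) * Complex.I) f)).im = 0 := by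
    rw [hval, hval]
    simp
  have h1 := H ((x : ℂ) + ε * Complex.I) (by simpa using hε')
  simp only [Function.comp_apply, Pi.mul_apply, zero_add, Complex.imCLM_apply, smul_eq_mul]
  rw [h0, sub_zero]
  exact mul_nonneg (inv_nonneg.2 hε'.le) h1

theorem eventually_multiAffineDiag_pos {n : ℕ} {S : Finset (Fin n)} {a : Finset (Fin n) → ℝ}
    (ha : 0 < a S) :
    ∀ᶠ y : ℝ in atTop, 0 < (-1 : ℝ) ^ S.card * (multiAffineDiag S a).eval (-y) := by
  have hterm : ∀ A ∈ S.powerset, Tendsto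
      (fun y : ℝ => (-1) ^ S.card * (-1) ^ A.card * a A * (y ^ A.card / y ^ S.card)) atTop
      (𝓝 (if A = S then a S else 0)) := by
    intro A hA
    by_cases hAS : A = S
    · subst hAS
      rw [if_pos rfl]
      refine tendsto_const_nhds.congr' ?_
      filter_upwards [eventually_gt_atTop 0] with y hy
      rw [div_self (by positivity), ← mul_pow]
      simp
    · rw [if_neg hAS]
      have hcard : A.card < S.card :=
        Finset.card_lt_card ((Finset.mem_powerset.1 hA).ssubset_of_ne hAS)
      simpa using (tendsto_pow_div_pow_atTop_zero hcard).const_mul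
        ((-1) ^ S.card * (-1) ^ A.card * a A)
  have hsum := tendsto_finsetSum _ hterm
  rw [Finset.sum_ite_eq' S.powerset S, if_pos (Finset.mem_powerset_self S)] at hsum
  filter_upwards [hsum.eventually (lt_mem_nhds ha), eventually_gt_atTop 0] with y hy hy0
  have e : (-1 : ℝ) ^ S.card * (multiAffineDiag S a).eval (-y) = y ^ S.card *
      ∑ A ∈ S.powerset, (-1) ^ S.card * (-1) ^ A.card * a A * (y ^ A.card / y ^ S.card) := by
    simp only [multiAffineDiag, Polynomial.eval_finsetSum, Finset.mul_sum]
    refine Finset.sum_congr rfl fun A _ => ?_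
    simp only [Polynomial.eval_mul, Polynomial.eval_C, Polynomial.eval_pow, Polynomial.eval_X]
    rw [neg_pow y]
    field_simp
  rw [e]
  positivity

theorem multiAffineDiag_pos_of_no_neg_root {n : ℕ} {S : Finset (Fin n)}
    {a : Finset (Fin n) → ℝ} (ha : 0 < a S)
    (hroots : ∀ x : ℝ, (multiAffineDiag S a).IsRoot x → 0 ≤ x) {x : ℝ} (hx : x < 0) :
    0 < (-1 : ℝ) ^ S.card * (multiAffineDiag S a).eval x := by
  by_contra! hneg
  obtain ⟨y, hy, hyx⟩ :=
    ((eventually_multiAffineDiag_pos ha).and (eventually_gt_atTop (-x))).exists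
  have hcont : ContinuousOn
      (fun t : ℝ => (-1 : ℝ) ^ S.card * (multiAffineDiag S a).eval t) (Set.Icc (-y) x) := by
    fun_prop
  obtain ⟨t, ht, ht0⟩ := intermediate_value_Icc' (by linarith) hcont ⟨hneg, hy.le⟩
  have : (multiAffineDiag S a).IsRoot t := by
    simpa using ht0
  linarith [hroots t this, ht.2]

theorem multiAffineDiag_deriv_pos {n : ℕ} {i : Fin n} {S : Finset (Fin n)}
    {a : Finset (Fin n) → ℝ} (hi : i ∉ S) (hst : WeaklyStable (insert i S) a)
    (ha : 0 < a (insert i S))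
    (hpos : ∀ x : ℝ, x < 0 →
      0 < (-1 : ℝ) ^ (insert i S).card * (multiAffineDiag (insert i S) a).eval x)
    {x : ℝ} (hx : x < 0) :
    0 < (-1 : ℝ) ^ S.card * (multiAffineDiag S (fun A => a (insert i A))).eval x := by
  set h := multiAffineDiag (insert i S) a
  set f := multiAffineDiag S (fun A => a (insert i A)) with hf
  have hW := wronskian_nonneg (h := h) (f := f) fun t ht => by
    have := hst i S hi rfl (fun _ => t) (fun _ => ht)
    rwa [multiAffineEval_const, multiAffineEval_const] at this
  have hne : ∀ y : ℝ, y < 0 → h.eval y ≠ 0 := fun y hy e => by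
    simpa [e] using hpos y hy
  have hanti : AntitoneOn (fun y => f.eval y / h.eval y) (Set.Iio 0) := by
    refine antitoneOn_of_deriv_nonpos (convex_Iio 0) ?_ ?_ ?_
    · exact f.continuous.continuousOn.div h.continuous.continuousOn hne
    · rw [interior_Iio]
      exact fun y hy => (f.differentiableAt.div h.differentiableAt
        (hne y hy)).differentiableWithinAt
    · rw [interior_Iio]
      intro y hy
      rw [((f.hasDerivAt y).fun_div (h.hasDerivAt y) (hne y hy)).deriv]
      exact div_nonpos_of_nonpos_of_nonneg (by linarith [hW y]) (sq_nonneg _)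
  obtain ⟨y, hy, hyx⟩ := ((eventually_multiAffineDiag_pos (S := S)
    (a := fun A => a (insert i A)) ha).and (eventually_gt_atTop (-x))).exists
  rw [← hf] at hy
  have hle : f.eval x / h.eval x ≤ f.eval (-y) / h.eval (-y) :=
    hanti (show -y < 0 by linarith) hx (by linarith)
  have hhx := hpos x hx
  have hhy := hpos (-y) (by linarith)
  rw [Finset.card_insert_of_notMem hi, pow_succ] at hhx hhy
  rcases neg_one_pow_eq_or ℝ S.card with hs | hs <;> rw [hs] at hy hhx hhy ⊢
  · have h1 : f.eval (-y) / h.eval (-y) < 0 := div_neg_of_pos_of_neg (by linarith) (by linarith)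
    have h2 : h.eval x < 0 := by linarith
    have h3 := hle.trans_lt h1
    rw [div_neg_iff] at h3
    rcases h3 with h3 | h3 <;> linarith [h3.1, h3.2]
  · have h1 : f.eval (-y) / h.eval (-y) < 0 := div_neg_of_neg_of_pos (by linarith) (by linarith)
    have h2 : 0 < h.eval x := by linarith
    have h3 := hle.trans_lt h1
    rw [div_neg_iff] at h3
    rcases h3 with h3 | h3 <;> linarith [h3.1, h3.2]

theorem multiAffineDiag_eval_zero {n : ℕ} (S : Finset (Fin n)) (a : Finset (Fin n) → ℝ) :
    (multiAffineDiag S a).eval 0 = a ∅ := by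
  rw [multiAffineDiag, Polynomial.eval_finsetSum, Finset.sum_eq_single ∅]
  · simp
  · intro A _ hA
    simp [hA]
  · simp

theorem WeaklyStable.coeff_sign {n : ℕ} {A : Finset (Fin n)} : ∀ {S : Finset (Fin n)}
    {a : Finset (Fin n) → ℝ}, WeaklyStable S a → 0 < a S →
    (∀ x : ℝ, x < 0 → 0 < (-1 : ℝ) ^ S.card * (multiAffineDiag S a).eval x) →
    A ⊆ S → 0 ≤ (-1 : ℝ) ^ (S.card - A.card) * a A := by
  induction A using Finset.induction_on with
  | empty =>
    intro S a _ _ hpos _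
    have hcont : Continuous
        (fun x : ℝ => (-1 : ℝ) ^ S.card * (multiAffineDiag S a).eval x) := by fun_prop
    have hlim := (hcont.tendsto 0).mono_left (nhdsWithin_le_nhds (s := Set.Iio 0))
    rw [multiAffineDiag_eval_zero] at hlim
    simp only [Finset.card_empty, Nat.sub_zero]
    refine ge_of_tendsto hlim ?_
    filter_upwards [self_mem_nhdsWithin] with x hx using (hpos x hx).le
  | insert i A hi ih =>
    intro S a hst ha hpos hAS
    obtain ⟨T, hiT, rfl⟩ : ∃ T, i ∉ T ∧ insert i T = S :=
      ⟨S.erase i, Finset.notMem_erase i S,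
        Finset.insert_erase (hAS (Finset.mem_insert_self i A))⟩
    have hAT : A ⊆ T := (Finset.insert_subset_insert_iff hi).1 hAS
    have := ih (hst.deriv hiT) ha
      (fun x hx => multiAffineDiag_deriv_pos hiT hst ha hpos hx) hAT
    rwa [Finset.card_insert_of_notMem hi, Finset.card_insert_of_notMem hiT,
      Nat.add_sub_add_right]

theorem expOf_apply {n : ℕ} (A : Finset (Fin n)) (k : Fin n) :
    expOf A k = if k ∈ A then 1 else 0 := by
  simp [expOf, Finsupp.finsetSum_apply, Finsupp.single_apply]

theorem expOf_injective {n : ℕ} : Function.Injective (expOf (n := n)) := by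
  intro A B hAB
  ext k
  have := DFunLike.congr_fun hAB k
  rw [expOf_apply, expOf_apply] at this
  by_cases h1 : k ∈ A <;> by_cases h2 : k ∈ B <;> simp_all

theorem MultiAffine.eq_sum {n : ℕ} {p : MvPolynomial (Fin n) ℝ} (hp : MultiAffine p) :
    p = ∑ A ∈ (Finset.univ : Finset (Fin n)).powerset,
      MvPolynomial.monomial (expOf A) (MvPolynomial.coeff (expOf A) p) := by
  classical
  rw [← Finset.sum_image (s := (Finset.univ : Finset (Fin n)).powerset) (g := expOf)
    (f := fun m => MvPolynomial.monomial m (MvPolynomial.coeff m p))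
    (fun A _ B _ h => expOf_injective h)]
  conv_lhs => rw [p.as_sum]
  refine Finset.sum_subset (fun m hm => ?_) (fun m _ hm => ?_)
  · refine Finset.mem_image.2 ⟨Finset.univ.filter fun k => m k = 1, by simp, ?_⟩
    ext k
    have hk : m k ≤ 1 := (MvPolynomial.monomial_le_degreeOf k hm).trans (hp k)
    rw [expOf_apply]
    by_cases h1 : m k = 1
    · simp [h1]
    · have : m k = 0 := by omega
      simp [this]
  · rw [MvPolynomial.notMem_support_iff.1 hm, MvPolynomial.monomial_zero]

theorem MultiAffine.aeval_eq {n : ℕ} {p : MvPolynomial (Fin n) ℝ} (hp : MultiAffine p)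
    {R : Type*} [CommRing R] [Algebra ℝ R] (z : Fin n → R) :
    MvPolynomial.aeval z p = ∑ A ∈ (Finset.univ : Finset (Fin n)).powerset,
      algebraMap ℝ R (MvPolynomial.coeff (expOf A) p) * ∏ i ∈ A, z i := by
  conv_lhs => rw [hp.eq_sum]
  rw [map_sum]
  refine Finset.sum_congr rfl fun A _ => ?_
  rw [MvPolynomial.aeval_monomial, Finsupp.prod_fintype _ _ fun _ => pow_zero _]
  simp [expOf_apply, pow_ite]

theorem stmt14 (n : ℕ) (p : MvPolynomial (Fin n) ℝ)
    (hstable : RealStable p) (hma : MultiAffine p)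
    (htop : 0 < MvPolynomial.coeff (expOf (Finset.univ : Finset (Fin n))) p)
    (hroots : ∀ x : ℝ, (diagPoly p).IsRoot x → 0 ≤ x) :
    ∀ A : Finset (Fin n), 0 ≤ (-1 : ℝ) ^ (n - A.card) * MvPolynomial.coeff (expOf A) p := by
  have hev : ∀ z : Fin n → ℂ, MvPolynomial.eval z (MvPolynomial.map (algebraMap ℝ ℂ) p) =
      multiAffineEval Finset.univ (fun A => MvPolynomial.coeff (expOf A) p) z := fun z => by
    rw [MvPolynomial.eval_map, ← MvPolynomial.aeval_def, hma.aeval_eq]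
    rfl
  have hdiag : diagPoly p =
      multiAffineDiag Finset.univ (fun A => MvPolynomial.coeff (expOf A) p) := by
    rw [diagPoly, hma.aeval_eq]
    simp [multiAffineDiag]
  rw [hdiag] at hroots
  intro A
  have hst := weaklyStable_of_ne_zero fun z hz => hev z ▸ hstable z hz
  simpa using hst.coeff_sign htop
    (fun x hx => multiAffineDiag_pos_of_no_neg_root htop hroots hx) (Finset.subset_univ A)
end

section
/- Let 𝔛 be a strongly Rayleigh point process on [n] and let λ_1,…,λ_n be the roots of the diagonalization ḡ_𝔛 of its kernel polynomial (these lie in [0,1]). Then H(𝔛) ≥ Σ_{i=1}^n h(λ_i). -/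
open MvPolynomial Polynomial

/-- `μ` is the law of a point process on `[n]`, i.e. a probability
distribution on subsets of `[n]`. -/
def IsPointProcess {n : ℕ} (μ : Finset (Fin n) → ℝ) : Prop :=
  (∀ A, 0 ≤ μ A) ∧ (∑ A : Finset (Fin n), μ A) = 1

/-- The probability generating polynomial `f_𝔛(z) = Σ_A ℙ(𝔛 = A) z^A`. -/
noncomputable def genPoly {n : ℕ} (μ : Finset (Fin n) → ℝ) : MvPolynomial (Fin n) ℝ :=
  ∑ A : Finset (Fin n), MvPolynomial.monomial (expOf A) (μ A)

/-- A point process is strongly Rayleigh if its probability generating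
polynomial is real stable. -/
def StronglyRayleigh {n : ℕ} (μ : Finset (Fin n) → ℝ) : Prop :=
  IsPointProcess μ ∧ RealStable (genPoly μ)

/-- `ℙ(A ⊆ 𝔛)`. -/
noncomputable def probSupset {n : ℕ} (μ : Finset (Fin n) → ℝ) (A : Finset (Fin n)) : ℝ :=
  ∑ B ∈ Finset.univ.filter (fun B : Finset (Fin n) => A ⊆ B), μ B

/-- The kernel polynomial `g_𝔛(z) = Σ_A (−1)^{|A|} ℙ(A ⊆ 𝔛) z^{A^c}`. -/
noncomputable def kernelPoly {n : ℕ} (μ : Finset (Fin n) → ℝ) : MvPolynomial (Fin n) ℝ :=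
  ∑ A : Finset (Fin n),
    MvPolynomial.monomial (expOf Aᶜ) ((-1 : ℝ) ^ A.card * probSupset μ A)

/-- Entropy (base 2) of a point process. By convention `0·log₂ 0 = 0`. -/
noncomputable def entropyPP {n : ℕ} (μ : Finset (Fin n) → ℝ) : ℝ :=
  -∑ A : Finset (Fin n), μ A * Real.logb 2 (μ A)

/-- Binary entropy `h(p) = −p log₂ p − (1−p) log₂ (1−p)` (with `h(0)=h(1)=0`). -/
noncomputable def binEnt (p : ℝ) : ℝ :=
  -(p * Real.logb 2 p) - (1 - p) * Real.logb 2 (1 - p)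

section StablePairs

variable {p q : ℝ[X]}

/-- `p + y q` is stable in both variables. -/
def StablePair (p q : ℝ[X]) : Prop :=
  ∀ z y : ℂ, 0 < z.im → 0 < y.im → Polynomial.aeval z p + y * Polynomial.aeval z q ≠ 0

theorem StablePair.im_nonneg (h : StablePair p q) {z : ℂ} (hz : 0 < z.im) :
    0 ≤ (Polynomial.aeval z p * (starRingEnd ℂ) (Polynomial.aeval z q)).im := by
  by_contra! hneg
  have hq : Polynomial.aeval z q ≠ 0 := by
    intro h0
    simp [h0] at hneg
  refine h z (-(Polynomial.aeval z p / Polynomial.aeval z q)) hz ?_ (by field_simp; ring)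
  rw [div_eq_mul_inv, Complex.inv_def, ← mul_assoc, Complex.neg_im, Complex.mul_im]
  have := inv_pos.2 (Complex.normSq_pos.2 hq)
  simp only [Complex.ofReal_im, mul_zero, Complex.ofReal_re, zero_add]
  nlinarith

theorem norm_add_I_mul_sq (a b : ℂ) :
    ‖a + Complex.I * b‖ ^ 2 - ‖a - Complex.I * b‖ ^ 2 = 4 * (a * (starRingEnd ℂ) b).im := by
  simp only [← Complex.normSq_eq_norm_sq, Complex.normSq_apply]
  simp
  ring

theorem StablePair.im_pos_or_proportional (h : StablePair p q) :
    (∀ z : ℂ, 0 < z.im →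
      0 < (Polynomial.aeval z p * (starRingEnd ℂ) (Polynomial.aeval z q)).im) ∨
    ∃ κ : ℂ, ∀ z : ℂ, 0 < z.im →
      Polynomial.aeval z p - Complex.I * Polynomial.aeval z q =
        κ * (Polynomial.aeval z p + Complex.I * Polynomial.aeval z q) := by
  rw [or_iff_not_imp_left]
  intro hne
  push Not at hne
  obtain ⟨z₀, hz₀, hle⟩ := hne
  set U : ℂ → ℂ := fun z => (Polynomial.aeval z p - Complex.I * Polynomial.aeval z q) /
    (Polynomial.aeval z p + Complex.I * Polynomial.aeval z q) with hU
  have hden : ∀ z : ℂ, 0 < z.im →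
      Polynomial.aeval z p + Complex.I * Polynomial.aeval z q ≠ 0 :=
    fun z hz => h z Complex.I hz (by simp)
  have hnorm : ∀ z : ℂ, 0 < z.im → ‖U z‖ ≤ 1 := by
    intro z hz
    rw [hU, norm_div, div_le_one (norm_pos_iff.2 (hden z hz))]
    have h1 := norm_add_I_mul_sq (Polynomial.aeval z p) (Polynomial.aeval z q)
    have h2 := h.im_nonneg hz
    exact abs_le_of_sq_le_sq' (by linarith) (norm_nonneg _) |>.2
  have hU0 : 1 ≤ ‖U z₀‖ := by
    rw [hU, norm_div, one_le_div (norm_pos_iff.2 (hden z₀ hz₀))]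
    have h1 := norm_add_I_mul_sq (Polynomial.aeval z₀ p) (Polynomial.aeval z₀ q)
    exact abs_le_of_sq_le_sq' (by linarith) (norm_nonneg _) |>.2
  refine ⟨U z₀, fun z hz => ?_⟩
  have hd : DifferentiableOn ℂ U {z : ℂ | 0 < z.im} := by
    intro z hz
    refine DifferentiableWithinAt.div ?_ ?_ (hden z hz)
    · exact ((Polynomial.differentiable_aeval p).sub
        ((Polynomial.differentiable_aeval q).const_mul _)).differentiableAt.differentiableWithinAt
    · exact ((Polynomial.differentiable_aeval p).add
        ((Polynomial.differentiable_aeval q).const_mul _)).differentiableAt.differentiableWithinAt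
  have := Complex.eqOn_of_isPreconnected_of_isMaxOn_norm
    (convex_halfSpace_im_gt 0).isPreconnected (isOpen_lt continuous_const Complex.continuous_im)
    hd hz₀ (fun w hw => (hnorm w hw).trans hU0) hz
  simp only [Function.const_apply] at this
  rw [← this, hU]
  field_simp [hden z hz]

theorem aeval_complex_ofReal (p : ℝ[X]) (t : ℝ) :
    Polynomial.aeval (t : ℂ) p = ((p.eval t : ℝ) : ℂ) :=
  Polynomial.aeval_ofReal p t

/-- The Wronskian of a stable pair is nonnegative on the real line. -/
theorem StablePair.wronskian_nonneg (h : StablePair p q) (t : ℝ) :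
    0 ≤ p.derivative.eval t * q.eval t - p.eval t * q.derivative.eval t := by
  have hd : ∀ r : ℝ[X], HasDerivAt (fun ε : ℝ => Polynomial.aeval ((t : ℂ) + Complex.I * ε) r)
      (Complex.I * (r.derivative.eval t : ℝ)) 0 := by
    intro r
    have h1 : HasDerivAt (fun ε : ℝ => (t : ℂ) + Complex.I * ε) Complex.I 0 := by
      simpa using ((Complex.ofRealCLM.hasDerivAt (x := 0)).const_mul Complex.I).const_add (t : ℂ)
    have h2 := r.hasDerivAt_aeval (t + Complex.I * ((0 : ℝ) : ℂ))
    have h3 := HasDerivAt.comp (0 : ℝ) h2 h1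
    simp only [Complex.ofReal_zero, mul_zero, add_zero, aeval_complex_ofReal] at h3
    rw [mul_comm]
    exact h3
  have hF : HasDerivAt (fun ε : ℝ => (Polynomial.aeval ((t : ℂ) + Complex.I * ε) p *
      (starRingEnd ℂ) (Polynomial.aeval ((t : ℂ) + Complex.I * ε) q)).im)
      (p.derivative.eval t * q.eval t - p.eval t * q.derivative.eval t) 0 := by
    have h1 := (hd p).mul ((Complex.conjCLE : ℂ →L[ℝ] ℂ).hasFDerivAt.comp_hasDerivAt (0 : ℝ) (hd q))
    have h2 := Complex.imCLM.hasFDerivAt.comp_hasDerivAt (0 : ℝ) h1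
    refine h2.congr_deriv ?_
    simp [aeval_complex_ofReal]
    ring
  refine ge_of_tendsto hF.tendsto_slope_zero_right ?_
  filter_upwards [self_mem_nhdsWithin] with ε hε
  have hε' : (0 : ℝ) < ε := hε
  have h1 := h.im_nonneg (z := (t : ℂ) + Complex.I * ε) (by simpa using hε')
  simp only [zero_add, Complex.ofReal_zero, mul_zero, add_zero, aeval_complex_ofReal,
    Complex.conj_ofReal,
    ← Complex.ofReal_mul, Complex.ofReal_im, sub_zero, smul_eq_mul]
  positivity

theorem StablePair.ratio_le (h : StablePair p q) (hq : ∀ t : ℝ, 0 < t → 0 < q.eval t)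
    {s t : ℝ} (hs : 0 < s) (hst : s ≤ t) :
    p.eval s * q.eval t ≤ p.eval t * q.eval s := by
  have hd : ∀ x : ℝ, 0 < x → HasDerivAt (fun x => p.eval x / q.eval x)
      ((p.derivative.eval x * q.eval x - p.eval x * q.derivative.eval x) / q.eval x ^ 2) x :=
    fun x hx => (p.hasDerivAt x).div (q.hasDerivAt x) (hq x hx).ne'
  have hm : MonotoneOn (fun x => p.eval x / q.eval x) (Set.Ioi 0) := by
    refine monotoneOn_of_deriv_nonneg (convex_Ioi 0)
      (fun x hx => (hd x hx).continuousAt.continuousWithinAt) ?_ ?_ <;> rw [interior_Ioi]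
    · exact fun x hx => (hd x hx).differentiableAt.differentiableWithinAt
    · intro x hx
      rw [(hd x hx).deriv]
      exact div_nonneg (h.wronskian_nonneg x) (sq_nonneg _)
  have := hm hs (hs.trans_le hst) hst
  rwa [div_le_div_iff₀ (hq s hs) (hq t (hs.trans_le hst))] at this

theorem StablePair.eval_mul_eq_of_proportional {κ : ℂ}
    (h : ∀ z : ℂ, 0 < z.im →
      Polynomial.aeval z p - Complex.I * Polynomial.aeval z q =
        κ * (Polynomial.aeval z p + Complex.I * Polynomial.aeval z q))
    (hq : q.eval 1 ≠ 0) (t : ℝ) : p.eval t * q.eval 1 = p.eval 1 * q.eval t := by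
  have hreal : ∀ t : ℝ, ((p.eval t : ℝ) : ℂ) - Complex.I * (q.eval t : ℝ) =
      κ * ((p.eval t : ℝ) + Complex.I * (q.eval t : ℝ)) := by
    intro t
    have hc : ∀ r : ℝ[X], Continuous (fun ε : ℝ => Polynomial.aeval ((t : ℂ) + Complex.I * ε) r) :=
      fun r => r.continuous_aeval.comp (by fun_prop)
    have ht : ∀ r : ℝ[X], Filter.Tendsto
        (fun ε : ℝ => Polynomial.aeval ((t : ℂ) + Complex.I * ε) r)
        (nhdsWithin 0 (Set.Ioi 0)) (nhds ((r.eval t : ℝ) : ℂ)) := by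
      intro r
      have := ((hc r).tendsto 0).mono_left (nhdsWithin_le_nhds (s := Set.Ioi 0))
      simpa [aeval_complex_ofReal] using this
    refine tendsto_nhds_unique (((ht p).sub ((ht q).const_mul _)).congr' ?_)
      (((ht p).add ((ht q).const_mul _)).const_mul κ)
    filter_upwards [self_mem_nhdsWithin] with ε hε
    exact h _ (by simpa using hε)
  have h1 := hreal 1
  have h2 := hreal t
  have hκ' : 1 - κ ≠ 0 := by
    intro h0
    have h3 : κ = 1 := by linear_combination -h0
    rw [h3] at h1
    have h4 : Complex.I * (q.eval 1 : ℝ) = 0 := by linear_combination (-1 / 2) * h1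
    simp at h4
    exact hq h4
  have h5 : (1 - κ) *
      ((p.eval t : ℝ) * (q.eval 1 : ℝ) - (p.eval 1 : ℝ) * (q.eval t : ℝ) : ℂ) = 0 := by
    linear_combination ((q.eval 1 : ℝ) : ℂ) * h2 - ((q.eval t : ℝ) : ℂ) * h1
  have h6 := (mul_eq_zero.1 h5).resolve_left hκ'
  exact_mod_cast sub_eq_zero.1 h6

/-- A Schwarz–Pick inequality for holomorphic self-maps of the right half-plane that are
real at two points of the positive axis. -/
theorem right_half_plane_schwarz_pick {φ : ℂ → ℂ} (hd : DifferentiableOn ℂ φ {ζ : ℂ | 0 < ζ.re})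
    (hmap : ∀ ζ : ℂ, 0 < ζ.re → 0 < (φ ζ).re) {c v x : ℝ} (hx : 0 < x) (h1 : φ 1 = c)
    (hv : φ x = v) :
    |v - c| * (x + 1) ≤ |x - 1| * (v + c) := by
  have hc : 0 < c := by simpa [h1] using hmap 1 (by simp)
  have hv0 : 0 < v := by simpa [hv] using hmap x (by simpa using hx)
  have hne : ∀ {w : ℂ}, 0 < w.re → w + c ≠ 0 := by
    intro w hw h0
    have := congrArg Complex.re h0
    simp at this
    linarith
  have hcay : ∀ u : ℂ, ‖u‖ < 1 → 0 < ((1 + u) / (1 - u)).re := by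
    intro u hu
    have hu1 : 1 - u ≠ 0 := by
      intro h0
      rw [← sub_eq_zero.1 h0] at hu
      simp at hu
    have h2 : Complex.normSq u < 1 := by
      rw [Complex.normSq_eq_norm_sq]
      nlinarith [norm_nonneg u]
    rw [Complex.div_re, ← add_div]
    refine div_pos ?_ (Complex.normSq_pos.2 hu1)
    rw [Complex.normSq_apply] at h2
    simp
    nlinarith
  have hcontr : ∀ w : ℂ, 0 < w.re → ‖(w - c) / (w + c)‖ ≤ 1 := by
    intro w hw
    rw [norm_div, div_le_one (norm_pos_iff.2 (hne hw))]
    refine (abs_le_of_sq_le_sq' ?_ (norm_nonneg _)).2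
    rw [← Complex.normSq_eq_norm_sq, ← Complex.normSq_eq_norm_sq, Complex.normSq_apply,
      Complex.normSq_apply]
    simp
    nlinarith
  have hu1 : ∀ u : ℂ, ‖u‖ < 1 → 1 - u ≠ 0 := by
    intro u hu h0
    rw [← sub_eq_zero.1 h0] at hu
    simp at hu
  have key := Complex.norm_le_norm_of_mapsTo_ball (R := 1)
    (f := fun u : ℂ => (φ ((1 + u) / (1 - u)) - c) / (φ ((1 + u) / (1 - u)) + c))
    (z := ((x - 1) / (x + 1) : ℝ)) ?_ ?_ ?_ ?_
  · have hx1 : (x + 1 : ℂ) ≠ 0 := by exact_mod_cast (by positivity : x + 1 ≠ 0)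
    have hz : (1 + (((x - 1) / (x + 1) : ℝ) : ℂ)) / (1 - (((x - 1) / (x + 1) : ℝ) : ℂ)) = x := by
      push_cast
      field_simp
      ring_nf
    simp only [hz, hv] at key
    rw [← Complex.ofReal_sub, ← Complex.ofReal_add, ← Complex.ofReal_div, Complex.norm_real,
      Complex.norm_real, Real.norm_eq_abs, Real.norm_eq_abs, abs_div, abs_div,
      abs_of_pos (add_pos hv0 hc), abs_of_pos (add_pos hx one_pos),
      div_le_div_iff₀ (by positivity) (by positivity)] at key
    exact key
  · have hball : ∀ u ∈ Metric.ball (0 : ℂ) 1, ‖u‖ < 1 := fun u hu => by simpa using hu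
    have hφ : DifferentiableOn ℂ (fun u : ℂ => φ ((1 + u) / (1 - u))) (Metric.ball 0 1) := by
      refine hd.comp (fun u hu => ?_) (fun u hu => hcay u (hball u hu))
      exact ((differentiableAt_id.const_add 1).div (differentiableAt_id.const_sub 1)
        (hu1 u (hball u hu))).differentiableWithinAt
    exact (hφ.sub_const _).div (hφ.add_const _) (fun u hu => hne (hmap _ (hcay u (hball u hu))))
  · intro u hu
    simpa using hcontr _ (hmap _ (hcay u (by simpa using hu)))
  · simp [h1]
  · rw [Complex.norm_real, Real.norm_eq_abs, abs_lt]
    constructor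
    · rw [lt_div_iff₀ (by positivity)]; linarith
    · rw [div_lt_iff₀ (by positivity)]; linarith

theorem StablePair.ratio_bound (h : StablePair p q) (hp : ∀ t : ℝ, 0 < t → 0 < p.eval t)
    (hq : ∀ t : ℝ, 0 < t → 0 < q.eval t) {t : ℝ} (ht : 0 < t) :
    (t ≤ 1 → t * (p.eval 1 * q.eval t) ≤ p.eval t * q.eval 1) ∧
    (1 ≤ t → p.eval t * q.eval 1 ≤ t * (p.eval 1 * q.eval t)) := by
  rcases h.im_pos_or_proportional with hpos | ⟨κ, hκ⟩
  swap
  · rw [eval_mul_eq_of_proportional hκ (hq 1 one_pos).ne' t]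
    have := mul_pos (hp 1 one_pos) (hq t ht)
    constructor <;> intro <;> nlinarith
  have hslit : ∀ z ∈ Complex.slitPlane, Polynomial.aeval z q ≠ 0 ∧
      Polynomial.aeval z p / Polynomial.aeval z q ∈ Complex.slitPlane := by
    have hup : ∀ z : ℂ, 0 < z.im → Polynomial.aeval z q ≠ 0 ∧
        (Polynomial.aeval z p / Polynomial.aeval z q).im ≠ 0 := by
      intro z hz
      have h1 := hpos z hz
      have h0 : Polynomial.aeval z q ≠ 0 := fun h0 => by simp [h0] at h1
      refine ⟨h0, ?_⟩
      rw [div_eq_mul_inv, Complex.inv_def, ← mul_assoc, Complex.mul_im]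
      have := inv_pos.2 (Complex.normSq_pos.2 h0)
      simp only [Complex.ofReal_im, mul_zero, Complex.ofReal_re, zero_add]
      positivity
    intro z hz
    rcases lt_trichotomy z.im 0 with hneg | hzero | hgt
    · have h1 := hup ((starRingEnd ℂ) z) (by simpa using hneg)
      rw [aeval_conj, aeval_conj, ← map_div₀, Complex.conj_im, neg_ne_zero] at h1
      exact ⟨by simpa using h1.1, Or.inr h1.2⟩
    · have hre : 0 < z.re := by
        rcases hz with hz | hz
        · exact hz
        · exact absurd hzero hz
      have hz' : z = ((z.re : ℝ) : ℂ) := by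
        apply Complex.ext <;> simp [hzero]
      rw [hz', aeval_complex_ofReal, aeval_complex_ofReal]
      refine ⟨by exact_mod_cast (hq _ hre).ne', Or.inl ?_⟩
      rw [← Complex.ofReal_div, Complex.ofReal_re]
      exact div_pos (hp _ hre) (hq _ hre)
    · exact ⟨(hup z hgt).1, Or.inr (hup z hgt).2⟩
  have hsq : ∀ ζ : ℂ, 0 < ζ.re → ζ ^ 2 ∈ Complex.slitPlane := by
    intro ζ hζ
    rw [Complex.mem_slitPlane_iff]
    by_cases h0 : ζ.im = 0
    · left
      simp [pow_two, h0]
      positivity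
    · right
      have : (ζ ^ 2).im = 2 * (ζ.re * ζ.im) := by simp [pow_two]; ring
      rw [this]
      positivity
  have hreal : ∀ x : ℝ, 0 < x →
      Complex.exp (Complex.log (Polynomial.aeval ((x : ℂ) ^ 2) p / Polynomial.aeval ((x : ℂ) ^ 2) q) / 2) =
      ((Real.sqrt (p.eval (x ^ 2) / q.eval (x ^ 2)) : ℝ) : ℂ) := by
    intro x hx
    have hN := div_pos (hp (x ^ 2) (by positivity)) (hq (x ^ 2) (by positivity))
    rw [← Complex.ofReal_pow, aeval_complex_ofReal, aeval_complex_ofReal, ← Complex.ofReal_div,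
      ← Complex.ofReal_log hN.le]
    rw [show ((Real.log (p.eval (x ^ 2) / q.eval (x ^ 2)) : ℝ) : ℂ) / 2 =
      ((Real.log (p.eval (x ^ 2) / q.eval (x ^ 2)) / 2 : ℝ) : ℂ) by push_cast; rfl,
      ← Complex.ofReal_exp, ← Real.log_sqrt hN.le, Real.exp_log (Real.sqrt_pos.2 hN)]
  have key := right_half_plane_schwarz_pick
    (φ := fun ζ => Complex.exp (Complex.log
      (Polynomial.aeval (ζ ^ 2) p / Polynomial.aeval (ζ ^ 2) q) / 2))
    (c := Real.sqrt (p.eval 1 / q.eval 1)) (v := Real.sqrt (p.eval t / q.eval t))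
    (x := Real.sqrt t) ?_ ?_ (Real.sqrt_pos.2 ht) ?_ ?_
  · have hx := Real.sqrt_pos.2 ht
    have hxt := Real.sq_sqrt ht.le
    have hN := div_pos (hp t ht) (hq t ht)
    have hM := div_pos (hp 1 one_pos) (hq 1 one_pos)
    have hv := Real.sqrt_pos.2 hN
    have hc := Real.sqrt_pos.2 hM
    have hvN := Real.sq_sqrt hN.le
    have hcM := Real.sq_sqrt hM.le
    have hqt := hq t ht
    have hq1 := hq 1 one_pos
    set x := Real.sqrt t
    set v := Real.sqrt (p.eval t / q.eval t)
    set c := Real.sqrt (p.eval 1 / q.eval 1)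
    have e1 : p.eval t = v ^ 2 * q.eval t := by rw [hvN]; field_simp
    have e2 : p.eval 1 = c ^ 2 * q.eval 1 := by rw [hcM]; field_simp
    have hqq := mul_pos hqt hq1
    rw [e1, e2]
    constructor
    · intro hx1
      have hx1' : x ≤ 1 := by nlinarith
      rw [abs_of_nonpos (by linarith : x - 1 ≤ 0)] at key
      have h2 : x * c ≤ v := by nlinarith [neg_abs_le (v - c)]
      have h3 : (x * c) ^ 2 ≤ v ^ 2 := by gcongr
      have h4 := mul_le_mul_of_nonneg_right h3 hqq.le
      rw [mul_pow, hxt] at h4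
      linarith
    · intro hx1
      have hx1' : 1 ≤ x := by nlinarith
      rw [abs_of_nonneg (by linarith : 0 ≤ x - 1)] at key
      have h2 : v ≤ x * c := by nlinarith [le_abs_self (v - c)]
      have h3 : v ^ 2 ≤ (x * c) ^ 2 := by gcongr
      have h4 := mul_le_mul_of_nonneg_right h3 hqq.le
      rw [mul_pow, hxt] at h4
      linarith
  · intro ζ hζ
    have hs := hslit _ (hsq ζ hζ)
    have hdr : ∀ r : ℝ[X], DifferentiableAt ℂ (fun ζ : ℂ => Polynomial.aeval (ζ ^ 2) r) ζ :=
      fun r => ((Polynomial.differentiable_aeval r).comp (differentiable_pow 2)) ζ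
    exact (((((hdr p).div (hdr q) hs.1).clog hs.2).div_const 2).cexp).differentiableWithinAt
  · intro ζ hζ
    have hs := Complex.mem_slitPlane_iff_arg.1 (hslit _ (hsq ζ hζ)).2
    rw [Complex.exp_re]
    refine mul_pos (Real.exp_pos _) (Real.cos_pos_of_mem_Ioo ?_)
    have h1 := Complex.neg_pi_lt_arg (Polynomial.aeval (ζ ^ 2) p / Polynomial.aeval (ζ ^ 2) q)
    have h2 := (Complex.arg_le_pi
      (Polynomial.aeval (ζ ^ 2) p / Polynomial.aeval (ζ ^ 2) q)).lt_of_ne hs.1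
    have h3 : (Complex.log (Polynomial.aeval (ζ ^ 2) p / Polynomial.aeval (ζ ^ 2) q) / 2).im =
        Complex.arg (Polynomial.aeval (ζ ^ 2) p / Polynomial.aeval (ζ ^ 2) q) / 2 := by
      rw [Complex.div_ofNat_im, Complex.log_im]
    rw [h3]
    constructor <;> linarith
  · simpa using hreal 1 one_pos
  · simpa [Real.sq_sqrt ht.le] using hreal (Real.sqrt t) (Real.sqrt_pos.2 ht)

end StablePairs

section EntropyComparison

theorem sum_mul_one_sub_mul_log_nonpos {ι : Type*} (s : Finset ι) (w p : ι → ℝ)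
    (hp : ∀ i ∈ s, 0 ≤ p i ∧ p i ≤ 1)
    (h : ∀ t : ℝ, 0 < t → t < 1 →
      0 ≤ ∑ i ∈ s, w i * (Real.log (1 - p i + p i * t) - p i * Real.log t)) :
    ∑ i ∈ s, w i * ((1 - p i) * Real.log (1 - p i)) ≤ 0 := by
  set M : ℝ → ℝ := fun t => ∑ i ∈ s, w i * (p i * (t * Real.log t) -
    (1 - p i + p i * t) * Real.log (1 - p i + p i * t)) with hM
  have hpos : ∀ i ∈ s, ∀ t : ℝ, 0 < t → t ≤ 1 → 0 < 1 - p i + p i * t := by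
    intro i hi t ht ht1
    rcases (hp i hi).2.eq_or_lt with h1 | h1
    · simpa [h1] using ht
    · have := mul_nonneg (hp i hi).1 ht.le
      linarith
  have hMd : ∀ t : ℝ, 0 < t → t ≤ 1 → HasDerivAt M
      (∑ i ∈ s, w i * (p i * (Real.log t - Real.log (1 - p i + p i * t)))) t := by
    intro t ht ht1
    refine HasDerivAt.fun_sum fun i hi => HasDerivAt.const_mul _ ?_
    have h1 := (Real.hasDerivAt_mul_log ht.ne').const_mul (p i)
    have h2 : HasDerivAt (fun t => 1 - p i + p i * t) (p i) t := by
      simpa using ((hasDerivAt_id t).const_mul (p i)).const_add (1 - p i)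
    have h3 := (Real.hasDerivAt_mul_log (hpos i hi t ht ht1).ne').comp t h2
    refine (h1.sub h3).congr_deriv ?_
    ring
  have hMc : Continuous M := by
    refine continuous_finsetSum _ fun i _ => continuous_const.mul ?_
    exact (continuous_const.mul Real.continuous_mul_log).sub
      (Real.continuous_mul_log.comp (by fun_prop : Continuous fun t : ℝ => 1 - p i + p i * t))
  have hM1 : M 1 = 0 := by simp [hM]
  have hmono : MonotoneOn (fun t => M t / (t - 1)) (Set.Ico 0 1) := by
    have hd : ∀ t ∈ Set.Ioo (0 : ℝ) 1, HasDerivAt (fun t => M t / (t - 1))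
        (((∑ i ∈ s, w i * (p i * (Real.log t - Real.log (1 - p i + p i * t)))) * (t - 1) -
          M t * 1) / (t - 1) ^ 2) t := fun t ht =>
      (hMd t ht.1 ht.2.le).div ((hasDerivAt_id t).sub_const 1) (sub_ne_zero.2 ht.2.ne)
    refine monotoneOn_of_deriv_nonneg (convex_Ico 0 1) ?_ ?_ ?_
    · exact hMc.continuousOn.div (by fun_prop) fun t ht => sub_ne_zero.2 ht.2.ne
    · rw [interior_Ico]
      exact fun t ht => (hd t ht).differentiableAt.differentiableWithinAt
    · rw [interior_Ico]
      intro t ht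
      rw [(hd t ht).deriv]
      refine div_nonneg ((h t ht.1 ht.2).trans_eq ?_) (sq_nonneg _)
      rw [hM, mul_one, Finset.sum_mul, ← Finset.sum_sub_distrib]
      exact Finset.sum_congr rfl fun i _ => by ring
  have hlim : Filter.Tendsto (fun t => M t / (t - 1)) (nhdsWithin 1 (Set.Iio 1)) (nhds 0) := by
    have h1 := hasDerivAt_iff_tendsto_slope.1 (hMd 1 one_pos le_rfl)
    have h2 := h1.mono_left (nhdsWithin_mono (1 : ℝ) (s := Set.Iio 1) fun x hx => ne_of_lt hx)
    simpa [slope_fun_def, hM1, div_eq_inv_mul] using h2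
  have h0 : M 0 / (0 - 1) ≤ 0 := by
    refine ge_of_tendsto hlim ?_
    filter_upwards [Ioo_mem_nhdsLT (zero_lt_one' ℝ)] with t ht
    exact hmono ⟨le_rfl, one_pos⟩ ⟨ht.1.le, ht.2⟩ ht.1.le
  refine Eq.trans_le ?_ h0
  simp [hM]

/-- Comparing the logarithmic transforms of a signed combination of Bernoulli laws compares
their entropies. -/
theorem sum_mul_binEntropy_nonneg {ι : Type*} (s : Finset ι) (w p : ι → ℝ)
    (hp : ∀ i ∈ s, 0 ≤ p i ∧ p i ≤ 1) (hmean : ∑ i ∈ s, w i * p i = 0)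
    (h : ∀ t : ℝ, 0 < t → 0 ≤ ∑ i ∈ s, w i * Real.log (1 - p i + p i * t)) :
    0 ≤ ∑ i ∈ s, w i * Real.binEntropy (p i) := by
  have hK : ∀ t : ℝ, 0 < t →
      0 ≤ ∑ i ∈ s, w i * (Real.log (1 - p i + p i * t) - p i * Real.log t) := by
    intro t ht
    simp only [mul_sub, Finset.sum_sub_distrib, ← mul_assoc, ← Finset.sum_mul, hmean]
    simpa using h t ht
  have h1 := sum_mul_one_sub_mul_log_nonpos s w p hp fun t ht _ => hK t ht
  have h2 := sum_mul_one_sub_mul_log_nonpos s w (fun i => 1 - p i)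
    (fun i hi => ⟨by linarith [(hp i hi).2], by linarith [(hp i hi).1]⟩) fun t ht ht1 => by
      refine (hK t⁻¹ (inv_pos.2 ht)).trans_eq (Finset.sum_congr rfl fun i hi => ?_)
      have hpos : 0 < p i + (1 - p i) * t := by
        obtain ⟨h0, h1⟩ := hp i hi
        nlinarith
      have e : 1 - p i + p i * t⁻¹ = (p i + (1 - p i) * t) * t⁻¹ := by field_simp; ring
      rw [e, Real.log_mul hpos.ne' (inv_pos.2 ht).ne', Real.log_inv]
      ring_nf
  simp only [sub_sub_cancel] at h2
  have h3 : ∑ i ∈ s, w i * Real.binEntropy (p i) =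
      -(∑ i ∈ s, w i * ((1 - p i) * Real.log (1 - p i)) +
        ∑ i ∈ s, w i * (p i * Real.log (p i))) := by
    rw [← Finset.sum_add_distrib, ← Finset.sum_neg_distrib]
    refine Finset.sum_congr rfl fun i _ => ?_
    rw [Real.binEntropy_eq_negMulLog_add_negMulLog_one_sub, Real.negMulLog, Real.negMulLog]
    ring
  rw [h3]
  linarith

theorem mul_log_mixture_le {m₀ m₁ a b t : ℝ} (hm₀ : 0 < m₀) (hm₁ : 0 < m₁) (ha : 0 < a)
    (hb : 0 < b) (ht : 0 < t) (h₁ : t ≤ 1 → a ≤ b ∧ t * b ≤ a) (h₂ : 1 ≤ t → b ≤ a ∧ a ≤ t * b) :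
    (m₀ + m₁) * (Real.log (m₀ * a + m₁ * (t * b)) - Real.log (m₀ + m₁ * t)) ≤
      m₀ * Real.log a + m₁ * Real.log b := by
  have hS : 0 < m₀ * a + m₁ * (t * b) := by positivity
  have hT : 0 < m₀ + m₁ * t := by positivity
  set S := m₀ * a + m₁ * (t * b) with hSdef
  have hJ := strictConcaveOn_log_Ioi.concaveOn.2 (Set.mem_Ioi.2 (inv_pos.2 ha))
    (Set.mem_Ioi.2 (inv_pos.2 hb)) (show 0 ≤ m₀ * a / S by positivity)
    (show 0 ≤ m₁ * (t * b) / S by positivity)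
    (by rw [← add_div, ← hSdef, div_self hS.ne'])
  have e : (m₀ * a / S) * a⁻¹ + (m₁ * (t * b) / S) * b⁻¹ = (m₀ + m₁ * t) / S := by field_simp
  simp only [smul_eq_mul] at hJ
  rw [e, Real.log_div hT.ne' hS.ne', Real.log_inv, Real.log_inv] at hJ
  have hsign : (t * b - a) * (Real.log b - Real.log a) ≤ 0 := by
    rcases le_total t 1 with h | h
    · have := Real.log_le_log ha (h₁ h).1
      exact mul_nonpos_of_nonpos_of_nonneg (by linarith [(h₁ h).2]) (by linarith)
    · have := Real.log_le_log hb (h₂ h).1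
      exact mul_nonpos_of_nonneg_of_nonpos (by linarith [(h₂ h).2]) (by linarith)
  have e2 : m₀ * Real.log a + m₁ * Real.log b =
      (m₀ + m₁) * (m₀ * a / S * Real.log a + m₁ * (t * b) / S * Real.log b) -
      m₀ * m₁ / S * ((t * b - a) * (Real.log b - Real.log a)) := by
    field_simp
    rw [hSdef]
    ring
  rw [e2]
  have h4 : m₀ * m₁ / S * ((t * b - a) * (Real.log b - Real.log a)) ≤ 0 :=
    mul_nonpos_of_nonneg_of_nonpos (by positivity) hsign
  have h5 : (m₀ + m₁) * (Real.log S - Real.log (m₀ + m₁ * t)) ≤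
      (m₀ + m₁) * (m₀ * a / S * Real.log a + m₁ * (t * b) / S * Real.log b) := by
    refine mul_le_mul_of_nonneg_left ?_ (by positivity)
    linarith
  linarith

end EntropyComparison

section SetWeights

theorem aeval_sum_C_mul_X_pow {κ R : Type*} [Fintype κ] [CommRing R] [Algebra ℝ R] (f : κ → ℝ)
    (e : κ → ℕ) (z : R) :
    Polynomial.aeval z (∑ A, Polynomial.C (f A) * Polynomial.X ^ e A) =
      ∑ A, algebraMap ℝ R (f A) * z ^ e A := by
  simp

variable {ι : Type*}

/-- The size generating function `∑ ν(A) t^|A|`. -/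
def sizeGen [Fintype ι] (ν : Finset ι → ℝ) (t : ℝ) : ℝ := ∑ A, ν A * t ^ A.card

theorem sizeGen_add [Fintype ι] (ν₀ ν₁ : Finset ι → ℝ) (t : ℝ) :
    sizeGen (ν₀ + ν₁) t = sizeGen ν₀ t + sizeGen ν₁ t := by
  simp [sizeGen, add_mul, Finset.sum_add_distrib]

theorem sizeGen_pos [Fintype ι] {ν : Finset ι → ℝ} (h : ∀ A, 0 ≤ ν A) (hν : ν ≠ 0) {t : ℝ}
    (ht : 0 < t) :
    0 < sizeGen ν t := by
  obtain ⟨A, hA⟩ := Function.ne_iff.1 hν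
  exact Finset.sum_pos' (fun B _ => mul_nonneg (h B) (pow_nonneg ht.le _))
    ⟨A, Finset.mem_univ _, mul_pos ((h A).lt_of_ne' hA) (pow_pos ht _)⟩

variable [DecidableEq ι]

/-- Multiply the weights of the sets containing `j` by `x`, those of the others by `y`. -/
def scaleAt (j : ι) (x y : ℝ) (ν : Finset ι → ℝ) : Finset ι → ℝ :=
  fun A => ν A * if j ∈ A then x else y

theorem scaleAt_add_scaleAt (j : ι) (ν : Finset ι → ℝ) :
    scaleAt j 0 1 ν + scaleAt j 1 0 ν = ν := by
  ext A
  by_cases hj : j ∈ A <;> simp [scaleAt, hj]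

theorem continuous_scaleAt (j : ι) (x y : ℝ) : Continuous (scaleAt j x y) :=
  continuous_pi fun A => (continuous_apply A).mul continuous_const

variable [Fintype ι]

/-- Stability of the multi-affine generating function of a weight on subsets. -/
def StableWeight (ν : Finset ι → ℝ) : Prop :=
  ∀ z : ι → ℂ, (∀ i, 0 < (z i).im) → ∑ A, (ν A : ℂ) * ∏ i ∈ A, z i ≠ 0

/-- The closure of the nonnegative stable weights. -/
def stableClosure (ι : Type*) [Fintype ι] : Set (Finset ι → ℝ) :=
  closure {ν | (∀ A, 0 ≤ ν A) ∧ StableWeight ν}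

theorem StableWeight.scaleAt {ν : Finset ι → ℝ} (h : StableWeight ν) (j : ι) {x y : ℝ}
    (hx : 0 < x) (hy : 0 < y) : StableWeight (scaleAt j x y ν) := by
  intro z hz
  have h1 := h (fun i => (if i = j then ((x / y : ℝ) : ℂ) else 1) * z i) (fun i => by
    split_ifs
    · rw [Complex.im_ofReal_mul]
      exact mul_pos (div_pos hx hy) (hz i)
    · simpa using hz i)
  have e : ∑ A, ((_root_.scaleAt j x y ν A : ℝ) : ℂ) * ∏ i ∈ A, z i = y * ∑ A, (ν A : ℂ) * ∏ i ∈ A,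
      ((if i = j then ((x / y : ℝ) : ℂ) else 1) * z i) := by
    rw [Finset.mul_sum]
    refine Finset.sum_congr rfl fun A _ => ?_
    have hy' : (y : ℂ) ≠ 0 := by exact_mod_cast hy.ne'
    rw [Finset.prod_mul_distrib, Finset.prod_ite_eq', _root_.scaleAt]
    split_ifs <;> push_cast <;> field_simp
  rw [e]
  exact mul_ne_zero (by exact_mod_cast hy.ne') h1

theorem scaleAt_mem_stableClosure_of_pos {ν : Finset ι → ℝ} (h : ν ∈ stableClosure ι) (j : ι)
    {x y : ℝ} (hx : 0 < x) (hy : 0 < y) : scaleAt j x y ν ∈ stableClosure ι := by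
  refine map_mem_closure (continuous_scaleAt j x y) h fun ν hν =>
    ⟨fun A => ?_, hν.2.scaleAt j hx hy⟩
  refine mul_nonneg (hν.1 A) ?_
  split_ifs <;> positivity

theorem scaleAt_mem_stableClosure {ν : Finset ι → ℝ} (h : ν ∈ stableClosure ι) (j : ι)
    {x y : ℝ} (hx : 0 ≤ x) (hy : 0 ≤ y) : scaleAt j x y ν ∈ stableClosure ι := by
  have hc : Continuous (fun ε : ℝ => scaleAt j (x + ε) (y + ε) ν) := by
    refine continuous_pi fun A => continuous_const.mul ?_
    split_ifs <;> fun_prop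
  have ht := (hc.tendsto 0).mono_left (nhdsWithin_le_nhds (s := Set.Ioi 0))
  simp only [add_zero] at ht
  refine isClosed_closure.mem_of_tendsto ht ?_
  filter_upwards [self_mem_nhdsWithin] with ε hε
  have hε' : (0 : ℝ) < ε := hε
  exact scaleAt_mem_stableClosure_of_pos h j (by positivity) (by positivity)

theorem continuous_sizeGen_scaleAt (j : ι) (x y t : ℝ) :
    Continuous fun ν : Finset ι → ℝ => sizeGen (scaleAt j x y ν) t :=
  continuous_finsetSum _ fun A _ =>
    ((continuous_apply A).comp (continuous_scaleAt j x y)).mul continuous_const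

/-- In a stable weight, the size tilted by `t` of the sets containing `j` and of those avoiding it
are comparable up to a factor `t`. -/
theorem sizeGen_ratio_of_stable {ν : Finset ι → ℝ} (h0 : ∀ A, 0 ≤ ν A) (h : StableWeight ν) (j : ι)
    {t : ℝ} (ht : 0 < t) :
    (t ≤ 1 → t * (sizeGen (scaleAt j 0 1 ν) t * sizeGen (scaleAt j 1 0 ν) 1) ≤
        sizeGen (scaleAt j 1 0 ν) t * sizeGen (scaleAt j 0 1 ν) 1 ∧
      sizeGen (scaleAt j 1 0 ν) t * sizeGen (scaleAt j 0 1 ν) 1 ≤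
        sizeGen (scaleAt j 0 1 ν) t * sizeGen (scaleAt j 1 0 ν) 1) ∧
    (1 ≤ t → sizeGen (scaleAt j 0 1 ν) t * sizeGen (scaleAt j 1 0 ν) 1 ≤
        sizeGen (scaleAt j 1 0 ν) t * sizeGen (scaleAt j 0 1 ν) 1 ∧
      sizeGen (scaleAt j 1 0 ν) t * sizeGen (scaleAt j 0 1 ν) 1 ≤
        t * (sizeGen (scaleAt j 0 1 ν) t * sizeGen (scaleAt j 1 0 ν) 1)) := by
  set p : ℝ[X] := ∑ A, Polynomial.C (scaleAt j 0 1 ν A) * Polynomial.X ^ A.card with hp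
  set q : ℝ[X] := ∑ A, Polynomial.C (scaleAt j 1 0 ν A) * Polynomial.X ^ (A.card - 1) with hq
  have ep : ∀ x : ℝ, p.eval x = sizeGen (scaleAt j 0 1 ν) x := by
    intro x
    simp [hp, sizeGen, Polynomial.eval_finsetSum]
  have eq' : ∀ x : ℝ, x * q.eval x = sizeGen (scaleAt j 1 0 ν) x := by
    intro x
    simp only [hq, sizeGen, Polynomial.eval_finsetSum, Finset.mul_sum]
    refine Finset.sum_congr rfl fun A _ => ?_
    by_cases hj : j ∈ A
    · have : A.card ≠ 0 := (Finset.card_pos.2 ⟨j, hj⟩).ne'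
      simp only [Polynomial.eval_mul, Polynomial.eval_C, Polynomial.eval_pow, Polynomial.eval_X]
      rw [mul_left_comm, mul_pow_sub_one this]
    · simp [scaleAt, hj]
  have hst : StablePair p q := by
    intro z y hz hy
    have h1 := h (fun i => if i = j then y else z) (fun i => by split_ifs <;> assumption)
    convert h1 using 1
    rw [hp, hq, aeval_sum_C_mul_X_pow, aeval_sum_C_mul_X_pow, Finset.mul_sum,
      ← Finset.sum_add_distrib]
    refine Finset.sum_congr rfl fun A _ => ?_
    by_cases hj : j ∈ A
    · rw [← Finset.mul_prod_erase A _ hj, Finset.prod_congr rfl (g := fun _ => z)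
        (fun i hi => if_neg (Finset.ne_of_mem_erase hi)), Finset.prod_const,
        Finset.card_erase_of_mem hj]
      simp [scaleAt, hj]
      ring
    · rw [Finset.prod_congr rfl (g := fun _ => z)
        (fun i hi => if_neg (ne_of_mem_of_not_mem hi hj)), Finset.prod_const]
      simp [scaleAt, hj]
  have hpos : ∀ (x y : ℝ) (e : Finset ι → ℕ), 0 ≤ x → 0 ≤ y →
      (∀ s : ℝ, 0 < s →
        0 < (∑ A, Polynomial.C (scaleAt j x y ν A) * Polynomial.X ^ e A : ℝ[X]).eval s) ∨
      (∑ A, Polynomial.C (scaleAt j x y ν A) * Polynomial.X ^ e A : ℝ[X]) = 0 := by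
    intro x y e hx hy
    have hnn : ∀ A, 0 ≤ scaleAt j x y ν A := fun A =>
      mul_nonneg (h0 A) (by split_ifs <;> assumption)
    by_cases hz : ∃ A, scaleAt j x y ν A ≠ 0
    · obtain ⟨A, hA⟩ := hz
      left
      intro s hs
      simp only [Polynomial.eval_finsetSum, Polynomial.eval_mul, Polynomial.eval_C,
        Polynomial.eval_pow, Polynomial.eval_X]
      exact Finset.sum_pos' (fun B _ => mul_nonneg (hnn B) (pow_nonneg hs.le _))
        ⟨A, Finset.mem_univ _, mul_pos ((hnn A).lt_of_ne' hA) (pow_pos hs _)⟩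
    · right
      push Not at hz
      simp [hz]
  have q1 : q.eval 1 = sizeGen (scaleAt j 1 0 ν) 1 := by rw [← eq', one_mul]
  rw [← ep, ← ep, ← eq' t, ← q1]
  rcases hpos 0 1 Finset.card le_rfl zero_le_one with hp' | hp'
  swap
  · rw [← hp] at hp'
    simp [hp']
  rcases hpos 1 0 (fun A => A.card - 1) zero_le_one le_rfl with hq' | hq'
  swap
  · rw [← hq] at hq'
    simp [hq']
  rw [← hp] at hp'
  rw [← hq] at hq'
  have hb := hst.ratio_bound hp' hq' ht
  refine ⟨fun h1 => ⟨?_, ?_⟩, fun h1 => ⟨?_, ?_⟩⟩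
  · have := mul_le_mul_of_nonneg_left (hst.ratio_le hq' ht h1) ht.le
    linarith
  · have := hb.1 h1
    linarith
  · have := hb.2 h1
    linarith
  · have := mul_le_mul_of_nonneg_left (hst.ratio_le hq' one_pos h1) ht.le
    linarith

theorem sizeGen_ratio {ν : Finset ι → ℝ} (h : ν ∈ stableClosure ι) (j : ι) {t : ℝ} (ht : 0 < t) :
    (t ≤ 1 → t * (sizeGen (scaleAt j 0 1 ν) t * sizeGen (scaleAt j 1 0 ν) 1) ≤
        sizeGen (scaleAt j 1 0 ν) t * sizeGen (scaleAt j 0 1 ν) 1 ∧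
      sizeGen (scaleAt j 1 0 ν) t * sizeGen (scaleAt j 0 1 ν) 1 ≤
        sizeGen (scaleAt j 0 1 ν) t * sizeGen (scaleAt j 1 0 ν) 1) ∧
    (1 ≤ t → sizeGen (scaleAt j 0 1 ν) t * sizeGen (scaleAt j 1 0 ν) 1 ≤
        sizeGen (scaleAt j 1 0 ν) t * sizeGen (scaleAt j 0 1 ν) 1 ∧
      sizeGen (scaleAt j 1 0 ν) t * sizeGen (scaleAt j 0 1 ν) 1 ≤
        t * (sizeGen (scaleAt j 0 1 ν) t * sizeGen (scaleAt j 1 0 ν) 1)) := by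
  have key : ∀ P : (Finset ι → ℝ) → Prop, IsClosed {ν | P ν} →
      (∀ ν, (∀ A, 0 ≤ ν A) → StableWeight ν → P ν) → P ν := fun P hP hS =>
    closure_minimal (fun ν hν => hS ν hν.1 hν.2) hP h
  have hl := (continuous_sizeGen_scaleAt j 0 1 t).mul (continuous_sizeGen_scaleAt j 1 0 1)
  have hr := (continuous_sizeGen_scaleAt j 1 0 t).mul (continuous_sizeGen_scaleAt j 0 1 1)
  have htl := hl.const_mul t
  refine ⟨fun h1 => ⟨?_, ?_⟩, fun h1 => ⟨?_, ?_⟩⟩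
  · exact key _ (isClosed_le htl hr) fun ν h0 hs => ((sizeGen_ratio_of_stable h0 hs j ht).1 h1).1
  · exact key _ (isClosed_le hr hl) fun ν h0 hs => ((sizeGen_ratio_of_stable h0 hs j ht).1 h1).2
  · exact key _ (isClosed_le hl hr) fun ν h0 hs => ((sizeGen_ratio_of_stable h0 hs j ht).2 h1).1
  · exact key _ (isClosed_le hr htl) fun ν h0 hs => ((sizeGen_ratio_of_stable h0 hs j ht).2 h1).2

end SetWeights

section BernoulliMajorant

variable {ι : Type*} [Fintype ι]

/-- A signed combination of Bernoulli laws with the mean and the (unnormalized) entropy of `ν`,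
whose logarithmic transform dominates that of the size law of `ν`. -/
structure IsBernoulliMajorant (ν : Finset ι → ℝ) (w : ℝ →₀ ℝ) : Prop where
  supported : w ∈ Finsupp.supported ℝ ℝ (Set.Icc (0 : ℝ) 1)
  entropy : Finsupp.linearCombination ℝ Real.binEntropy w =
    ∑ A, Real.negMulLog (ν A) - Real.negMulLog (sizeGen ν 1)
  mean : Finsupp.linearCombination ℝ (fun p : ℝ => p) w = ∑ A, ν A * A.card
  log_le : ∀ t : ℝ, 0 < t → sizeGen ν 1 * (Real.log (sizeGen ν t) - Real.log (sizeGen ν 1)) ≤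
    Finsupp.linearCombination ℝ (fun p : ℝ => Real.log (1 - p + p * t)) w

theorem isBernoulliMajorant_zero : IsBernoulliMajorant (0 : Finset ι → ℝ) 0 where
  supported := zero_mem _
  entropy := by simp [sizeGen]
  mean := by simp
  log_le t ht := by simp [sizeGen]

variable [DecidableEq ι]

theorem sizeGen_single (A : Finset ι) (m t : ℝ) : sizeGen (Pi.single A m) t = m * t ^ A.card := by
  rw [sizeGen, Finset.sum_eq_single A (by simp +contextual) (by simp)]
  simp

theorem isBernoulliMajorant_single (A : Finset ι) (m : ℝ) :
    IsBernoulliMajorant (Pi.single A m) (Finsupp.single 1 (m * A.card)) where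
  supported := Finsupp.single_mem_supported ℝ _ (by simp)
  entropy := by
    rw [Finset.sum_eq_single A (by simp +contextual) (by simp)]
    rw [Finsupp.linearCombination_single, sizeGen_single]
    simp
  mean := by
    rw [Finset.sum_eq_single A (by simp +contextual) (by simp), Finsupp.linearCombination_single]
    simp
  log_le t ht := by
    rcases eq_or_ne m 0 with rfl | hm
    · simp [sizeGen]
    · simp only [sizeGen_single, Finsupp.linearCombination_single, smul_eq_mul]
      rw [Real.log_mul hm (by positivity), Real.log_pow]
      simp
      linarith

theorem mul_binEntropy_div {m₀ m₁ : ℝ} (h₀ : 0 < m₀) (h₁ : 0 < m₁) :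
    (m₀ + m₁) * Real.binEntropy (m₁ / (m₀ + m₁)) =
      Real.negMulLog m₀ + Real.negMulLog m₁ - Real.negMulLog (m₀ + m₁) := by
  have e : 1 - m₁ / (m₀ + m₁) = m₀ / (m₀ + m₁) := by field_simp; ring
  have h : m₀ + m₁ ≠ 0 := by positivity
  rw [Real.binEntropy_eq_negMulLog_add_negMulLog_one_sub, e, Real.negMulLog, Real.negMulLog,
    Real.log_div h₀.ne' h, Real.log_div h₁.ne' h, Real.negMulLog, Real.negMulLog, Real.negMulLog]
  field_simp
  ring

theorem IsBernoulliMajorant.of_scaleAt {ν : Finset ι → ℝ} (hν : ν ∈ stableClosure ι) (j : ι)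
    (hpos : ∀ t, 0 < t → 0 < sizeGen (scaleAt j 0 1 ν) t ∧ 0 < sizeGen (scaleAt j 1 0 ν) t)
    {w₀ w₁ : ℝ →₀ ℝ}
    (hw₀ : IsBernoulliMajorant (scaleAt j 0 1 ν) w₀)
    (hw₁ : IsBernoulliMajorant (scaleAt j 1 0 ν) w₁) :
    IsBernoulliMajorant ν
      (Finsupp.single (sizeGen (scaleAt j 1 0 ν) 1 / sizeGen ν 1) (sizeGen ν 1) +
        Finsupp.single 1 (-sizeGen (scaleAt j 1 0 ν) 1) + w₀ + w₁) := by
  have hg : ∀ t, sizeGen ν t = sizeGen (scaleAt j 0 1 ν) t + sizeGen (scaleAt j 1 0 ν) t :=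
    fun t => by rw [← sizeGen_add, scaleAt_add_scaleAt]
  obtain ⟨h₀, h₁⟩ := hpos 1 one_pos
  have hE₀ := hw₀.entropy
  have hE₁ := hw₁.entropy
  have hM₀ := hw₀.mean
  have hM₁ := hw₁.mean
  have hL₀ := hw₀.log_le
  have hL₁ := hw₁.log_le
  rw [hg 1]
  set m₀ := sizeGen (scaleAt j 0 1 ν) 1
  set m₁ := sizeGen (scaleAt j 1 0 ν) 1
  have hm : 0 < m₀ + m₁ := by positivity
  refine ⟨?_, ?_, ?_, fun t ht => ?_⟩
  · refine add_mem (add_mem (add_mem ?_ ?_) hw₀.supported) hw₁.supported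
    · exact Finsupp.single_mem_supported ℝ _
        ⟨by positivity, (div_le_one hm).2 (by linarith)⟩
    · exact Finsupp.single_mem_supported ℝ _ (by simp)
  · simp only [map_add, Finsupp.linearCombination_single, smul_eq_mul, hE₀, hE₁,
      mul_binEntropy_div h₀ h₁, Real.binEntropy_one, mul_zero, hg 1]
    have e : ∑ A, Real.negMulLog (ν A) = ∑ A, Real.negMulLog (scaleAt j 0 1 ν A) +
        ∑ A, Real.negMulLog (scaleAt j 1 0 ν A) := by
      rw [← Finset.sum_add_distrib]
      refine Finset.sum_congr rfl fun A _ => ?_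
      by_cases hj : j ∈ A <;> simp [scaleAt, hj]
    rw [e]
    ring
  · simp only [map_add, Finsupp.linearCombination_single, smul_eq_mul, hM₀, hM₁]
    have e : ∑ A, ν A * (A.card : ℝ) = ∑ A, scaleAt j 0 1 ν A * (A.card : ℝ) +
        ∑ A, scaleAt j 1 0 ν A * (A.card : ℝ) := by
      rw [← Finset.sum_add_distrib]
      refine Finset.sum_congr rfl fun A _ => ?_
      by_cases hj : j ∈ A <;> simp [scaleAt, hj]
    rw [e, mul_div_cancel₀ _ hm.ne']
    ring
  · obtain ⟨ha, hc⟩ := hpos t ht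
    have hra := sizeGen_ratio hν j ht
    replace hL₀ := hL₀ t ht
    replace hL₁ := hL₁ t ht
    simp only [map_add, Finsupp.linearCombination_single, smul_eq_mul, hg 1, hg t]
    set a := sizeGen (scaleAt j 0 1 ν) t
    set c := sizeGen (scaleAt j 1 0 ν) t
    have hmix := mul_log_mixture_le h₀ h₁ (div_pos ha h₀) (div_pos hc (mul_pos ht h₁)) ht
      (fun h => ⟨by
          rw [div_le_div_iff₀ h₀ (mul_pos ht h₁)]
          linarith [(hra.1 h).1], by
          rw [← mul_div_assoc, mul_div_mul_left _ _ ht.ne', div_le_div_iff₀ h₁ h₀]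
          exact (hra.1 h).2⟩)
      (fun h => ⟨by
          rw [div_le_div_iff₀ (mul_pos ht h₁) h₀]
          linarith [(hra.2 h).2], by
          rw [← mul_div_assoc, mul_div_mul_left _ _ ht.ne', div_le_div_iff₀ h₀ h₁]
          exact (hra.2 h).1⟩)
    have e1 : m₀ * (a / m₀) + m₁ * (t * (c / (t * m₁))) = a + c := by field_simp
    have e2 : 1 - m₁ / (m₀ + m₁) + m₁ / (m₀ + m₁) * t = (m₀ + m₁ * t) / (m₀ + m₁) := by
      field_simp
      ring
    have e3 : (1 : ℝ) - 1 + 1 * t = t := by ring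
    rw [e1, Real.log_div ha.ne' h₀.ne', Real.log_div hc.ne' (by positivity),
      Real.log_mul ht.ne' h₁.ne'] at hmix
    rw [e2, e3, Real.log_div (by positivity) hm.ne']
    linarith

theorem exists_isBernoulliMajorant (S : Finset ι) : ∀ ν : Finset ι → ℝ, (∀ A, 0 ≤ ν A) →
    ν ∈ stableClosure ι → (∀ A B, ν A ≠ 0 → ν B ≠ 0 → A \ S = B \ S) →
    ∃ w, IsBernoulliMajorant ν w := by
  induction S using Finset.induction_on with
  | empty =>
    intro ν _ _ hs
    rcases eq_or_ne ν 0 with rfl | hν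
    · exact ⟨0, isBernoulliMajorant_zero⟩
    · obtain ⟨A, hA⟩ := Function.ne_iff.1 hν
      have e : ν = Pi.single A (ν A) := by
        ext B
        rcases eq_or_ne B A with rfl | hB
        · simp
        · rw [Pi.single_eq_of_ne hB]
          by_contra h
          exact hB (by simpa using hs B A h hA)
      rw [e]
      exact ⟨_, isBernoulliMajorant_single A (ν A)⟩
  | insert j S _ ih =>
    intro ν h0 hν hs
    have hsdiff : ∀ {A B : Finset ι}, (j ∈ A ↔ j ∈ B) → A \ insert j S = B \ insert j S →
        A \ S = B \ S := by
      intro A B hj h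
      ext i
      have := Finset.ext_iff.1 h i
      rcases eq_or_ne i j with rfl | hi
      · simp [hj]
      · simpa [hi] using this
    have hex : ∀ x y : ℝ, 0 ≤ x → 0 ≤ y → (x = 0 ∨ y = 0) →
        (∀ A, 0 ≤ scaleAt j x y ν A) ∧ ∃ w, IsBernoulliMajorant (scaleAt j x y ν) w := by
      intro x y hx hy hxy
      have hnn : ∀ A, 0 ≤ scaleAt j x y ν A := fun A =>
        mul_nonneg (h0 A) (by split_ifs <;> assumption)
      refine ⟨hnn, ih _ hnn (scaleAt_mem_stableClosure hν j hx hy) fun A B hA hB => ?_⟩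
      refine hsdiff ?_ (hs A B (left_ne_zero_of_mul hA) (left_ne_zero_of_mul hB))
      have hA' := right_ne_zero_of_mul hA
      have hB' := right_ne_zero_of_mul hB
      rcases hxy with rfl | rfl <;> by_cases h1 : j ∈ A <;> by_cases h2 : j ∈ B <;> simp_all
    obtain ⟨hnn₀, w₀, hw₀⟩ := hex 0 1 le_rfl zero_le_one (Or.inl rfl)
    obtain ⟨hnn₁, w₁, hw₁⟩ := hex 1 0 zero_le_one le_rfl (Or.inr rfl)
    have hadd := scaleAt_add_scaleAt j ν
    by_cases hz₀ : scaleAt j 0 1 ν = 0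
    · rw [hz₀, zero_add] at hadd
      exact ⟨w₁, hadd ▸ hw₁⟩
    by_cases hz₁ : scaleAt j 1 0 ν = 0
    · rw [hz₁, add_zero] at hadd
      exact ⟨w₀, hadd ▸ hw₀⟩
    have hpos : ∀ t, 0 < t → 0 < sizeGen (scaleAt j 0 1 ν) t ∧ 0 < sizeGen (scaleAt j 1 0 ν) t :=
      fun t ht => ⟨sizeGen_pos hnn₀ hz₀ ht, sizeGen_pos hnn₁ hz₁ ht⟩
    exact ⟨_, .of_scaleAt hν j hpos hw₀ hw₁⟩

end BernoulliMajorant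

section DiagonalKernel

variable {n : ℕ}

theorem aeval_monomial_expOf {R : Type*} [CommRing R] [Algebra ℝ R] (A : Finset (Fin n)) (c : ℝ)
    (z : Fin n → R) :
    MvPolynomial.aeval z (MvPolynomial.monomial (expOf A) c) =
      algebraMap ℝ R c * ∏ i ∈ A, z i := by
  have h : ∀ i, expOf A i = if i ∈ A then 1 else 0 := fun i => by
    simp [expOf, Finsupp.finsetSum_apply, Finsupp.single_apply]
  rw [MvPolynomial.aeval_monomial, Finsupp.prod_fintype _ _ (fun i => pow_zero _)]
  simp [h, pow_ite, Finset.prod_ite_mem]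

theorem stableWeight_of_realStable {μ : Finset (Fin n) → ℝ} (h : RealStable (genPoly μ)) :
    StableWeight μ := by
  intro z hz
  have h1 := h z hz
  rw [MvPolynomial.eval_map, ← MvPolynomial.aeval_def, genPoly, map_sum] at h1
  simpa only [aeval_monomial_expOf, Complex.coe_algebraMap] using h1

theorem eval_diagPoly_kernelPoly (μ : Finset (Fin n) → ℝ) (x : ℝ) :
    (diagPoly (kernelPoly μ)).eval x = ∑ B, μ B * (x ^ (n - B.card) * (x - 1) ^ B.card) := by
  simp only [diagPoly, kernelPoly, map_sum, aeval_monomial_expOf, Finset.prod_const,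
    Polynomial.eval_finsetSum, Polynomial.algebraMap_eq, Polynomial.eval_mul, Polynomial.eval_C,
    Polynomial.eval_pow, Polynomial.eval_X, probSupset, Finset.sum_filter, Finset.mul_sum]
  rw [Finset.sum_comm]
  refine Finset.sum_congr rfl fun B _ => ?_
  rw [sub_eq_neg_add, ← Finset.sum_pow_mul_eq_add_pow, Finset.mul_sum, Finset.mul_sum]
  rw [← Finset.sum_subset (Finset.subset_univ B.powerset)]
  · refine Finset.sum_congr rfl fun A hA => ?_
    have hAB := Finset.mem_powerset.1 hA
    have hc := Finset.card_le_card hAB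
    have hn : B.card ≤ n := card_finset_fin_le B
    rw [if_pos hAB, Finset.card_compl, Fintype.card_fin,
      show n - A.card = (n - B.card) + (B.card - A.card) by omega, pow_add]
    ring
  · intro A _ hA
    rw [if_neg (by simpa using hA)]
    simp

theorem sizeGen_eq_prod {μ : Finset (Fin n) → ℝ} (hμ : ∑ A, μ A = 1) {lam : Fin n → ℝ}
    (hlam : diagPoly (kernelPoly μ) = ∏ i, (Polynomial.X - Polynomial.C (lam i))) (t : ℝ) :
    sizeGen μ t = ∏ i, (1 - lam i + lam i * t) := by
  rcases eq_or_ne t 1 with rfl | ht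
  · simp [sizeGen, hμ]
  have hs : 1 - t ≠ 0 := sub_ne_zero.2 ht.symm
  have h := congrArg (fun q => (1 - t) ^ n * q.eval (1 - t)⁻¹) hlam
  simp only [eval_diagPoly_kernelPoly, Polynomial.eval_prod, Polynomial.eval_sub,
    Polynomial.eval_X, Polynomial.eval_C] at h
  have e : (1 - t) ^ n = ∏ _i : Fin n, (1 - t) := by simp
  rw [Finset.mul_sum] at h
  nth_rewrite 2 [e] at h
  rw [← Finset.prod_mul_distrib] at h
  convert h using 1
  · refine Finset.sum_congr rfl fun B _ => ?_
    have hn : B.card ≤ n := card_finset_fin_le B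
    have e1 : (1 - t)⁻¹ - 1 = t * (1 - t)⁻¹ := by field_simp; ring
    have e2 : (1 - t) ^ n = (1 - t) ^ (n - B.card) * (1 - t) ^ B.card := by
      rw [← pow_add, Nat.sub_add_cancel hn]
    rw [e1, e2, mul_pow, inv_pow, inv_pow]
    field_simp
  · refine Finset.prod_congr rfl fun i _ => ?_
    rw [mul_sub, mul_inv_cancel₀ hs]
    ring

theorem mem_Icc_of_forall_ne_zero {p : ℝ} (h : ∀ t : ℝ, 0 < t → 1 - p + p * t ≠ 0) :
    0 ≤ p ∧ p ≤ 1 := by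
  have key : ∀ hp : p ≠ 0, ¬ 0 < 1 - p⁻¹ := fun hp ht => h _ ht (by field_simp; ring)
  constructor
  · by_contra! hp
    exact key hp.ne (by linarith [inv_lt_zero.2 hp])
  · by_contra! hp
    exact key (by positivity) (by linarith [inv_lt_one_of_one_lt₀ hp])

theorem sum_mul_card_eq_sum {ι κ : Type*} [Fintype ι] [Fintype κ] {ν : Finset ι → ℝ} {p : κ → ℝ}
    (h : ∀ t, sizeGen ν t = ∏ i, (1 - p i + p i * t)) : ∑ A, ν A * A.card = ∑ i, p i := by
  classical
  have h1 : HasDerivAt (sizeGen ν) (∑ A, ν A * A.card) 1 := by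
    refine HasDerivAt.fun_sum fun A _ => HasDerivAt.const_mul _ ?_
    simpa using hasDerivAt_pow A.card (1 : ℝ)
  have h2 : HasDerivAt (fun t : ℝ => ∏ i, (1 - p i + p i * t)) (∑ i, p i) 1 := by
    have h3 : ∀ i ∈ Finset.univ, HasDerivAt (fun t : ℝ => 1 - p i + p i * t) (p i) 1 :=
        fun i _ => by
      simpa using ((hasDerivAt_id (1 : ℝ)).const_mul (p i)).const_add (1 - p i)
    simpa using HasDerivAt.fun_finsetProd h3
  rw [← funext h] at h2
  exact h1.unique h2

end DiagonalKernel

theorem entropyPP_eq_div {n : ℕ} (μ : Finset (Fin n) → ℝ) :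
    entropyPP μ = (∑ A, Real.negMulLog (μ A)) / Real.log 2 := by
  simp only [entropyPP, Real.negMulLog, Real.logb, Finset.sum_div, ← Finset.sum_neg_distrib]
  exact Finset.sum_congr rfl fun A _ => by ring

theorem binEnt_eq_div (p : ℝ) : binEnt p = Real.binEntropy p / Real.log 2 := by
  rw [binEnt, Real.binEntropy_eq_negMulLog_add_negMulLog_one_sub, Real.negMulLog, Real.negMulLog,
    Real.logb, Real.logb]
  ring

/-- A Bernoulli majorant of `ν` has at least the entropy of the Bernoulli laws whose sum has the
size law of `ν`. -/
theorem IsBernoulliMajorant.sum_binEntropy_le {ι κ : Type*} [Fintype ι] [Fintype κ]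
    {ν : Finset ι → ℝ} {w : ℝ →₀ ℝ} (hw : IsBernoulliMajorant ν w) {p : κ → ℝ}
    (hp : ∀ i, 0 ≤ p i ∧ p i ≤ 1) (hpos : ∀ t, 0 < t → 0 < sizeGen ν t)
    (h : ∀ t, sizeGen ν t = ∏ i, (1 - p i + p i * t)) :
    ∑ i, Real.binEntropy (p i) ≤ ∑ A, Real.negMulLog (ν A) := by
  have h1 : sizeGen ν 1 = 1 := by simp [h]
  have hlin : ∀ f : ℝ → ℝ,
      Finsupp.linearCombination ℝ f (w - ∑ i, Finsupp.single (p i) 1) =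
        Finsupp.linearCombination ℝ f w - ∑ i, f (p i) := fun f => by
    simp [map_sum, Finsupp.linearCombination_single]
  set w' := w - ∑ i, Finsupp.single (p i) 1
  have hsum : ∀ f : ℝ → ℝ, ∑ x ∈ w'.support, w' x * f x = Finsupp.linearCombination ℝ f w' :=
    fun f => by simp [Finsupp.linearCombination_apply, Finsupp.sum]
  have hsupp : w' ∈ Finsupp.supported ℝ ℝ (Set.Icc (0 : ℝ) 1) :=
    sub_mem hw.supported (sum_mem fun i _ => Finsupp.single_mem_supported ℝ _ (hp i))
  have key := sum_mul_binEntropy_nonneg w'.support w' (fun x => x)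
    (fun x hx => (Finsupp.mem_supported ℝ w').1 hsupp hx)
    (by rw [hsum (fun x => x), hlin, hw.mean, sum_mul_card_eq_sum h, sub_self])
    (fun t ht => by
      rw [hsum (fun x => Real.log (1 - x + x * t)), hlin, sub_nonneg]
      have h2 := hw.log_le t ht
      have h3 := (hpos t ht).ne'
      rw [h] at h3
      rw [h1, Real.log_one, h, Real.log_prod (Finset.prod_ne_zero_iff.1 h3)] at h2
      linarith)
  rw [hsum Real.binEntropy, hlin, hw.entropy, h1, Real.negMulLog_one] at key
  linarith

theorem stmt18 (n : ℕ) (μ : Finset (Fin n) → ℝ) (hμ : StronglyRayleigh μ)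
    (lam : Fin n → ℝ)
    (hlam : diagPoly (kernelPoly μ) = ∏ i, (Polynomial.X - Polynomial.C (lam i))) :
    entropyPP μ ≥ ∑ i, binEnt (lam i) := by
  obtain ⟨⟨h0, h1⟩, hs⟩ := hμ
  have hne : μ ≠ 0 := by
    rintro rfl
    simp at h1
  have hprod := sizeGen_eq_prod h1 hlam
  have hpos : ∀ t, 0 < t → 0 < sizeGen μ t := fun t ht => sizeGen_pos h0 hne ht
  have hp : ∀ i, 0 ≤ lam i ∧ lam i ≤ 1 := fun i => mem_Icc_of_forall_ne_zero fun t ht => by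
    have h2 := (hpos t ht).ne'
    rw [hprod] at h2
    exact Finset.prod_ne_zero_iff.1 h2 i (Finset.mem_univ i)
  obtain ⟨w, hw⟩ := exists_isBernoulliMajorant Finset.univ μ h0
    (subset_closure ⟨h0, stableWeight_of_realStable hs⟩) fun A B _ _ => by
      rw [Finset.sdiff_eq_empty_iff_subset.2 (Finset.subset_univ A),
        Finset.sdiff_eq_empty_iff_subset.2 (Finset.subset_univ B)]
  simp only [entropyPP_eq_div, binEnt_eq_div, ← Finset.sum_div, ge_iff_le]
  exact div_le_div_of_nonneg_right (hw.sum_binEntropy_le hp hpos hprod)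
    (Real.log_nonneg one_le_two)
end
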